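/- Let G₂ and F₂ be even real polynomials with deg G₂ ≥ 2 and G₂(x) → +∞ as |x| → ∞. Then for every integer q ≥ 1 and every compact set U₀ ⊂ ℝ² there exist ε₀ > 0, nonzero real numbers b₀, b₁, …, b_q, and a compact set U ⊂ ℝ² with U ∩ U₀ = ∅, such that for all real λ, μ with |λ| ≤ ε₀ and 0 < |μ| ≤ ε₀, the planar system ẋ = y − (λF₂(x) + μ·Σ_{j=0}^{q} b_j x^{2j+1}), ẏ = −G₂'(x) has at least q pairwise distinct limit cycles all contained in U. -/

import Mathlib

open Filter Polynomial

/-- `Γ` is a periodic orbit of the planar vector field `V`: the image of a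
nonconstant periodic solution of `γ' = V ∘ γ`. -/
def IsPeriodicOrbit (V : ℝ × ℝ → ℝ × ℝ) (Γ : Set (ℝ × ℝ)) : Prop :=
  ∃ γ : ℝ → ℝ × ℝ,
    (∀ t : ℝ, HasDerivAt γ (V (γ t)) t) ∧
    (∃ T : ℝ, 0 < T ∧ Function.Periodic γ T) ∧
    (∃ t₁ t₂ : ℝ, γ t₁ ≠ γ t₂) ∧
    Γ = Set.range γ

/-- `Γ` is a limit cycle of `V`: a periodic orbit which is isolated among
periodic orbits. -/
def IsLimitCycle (V : ℝ × ℝ → ℝ × ℝ) (Γ : Set (ℝ × ℝ)) : Prop :=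
  IsPeriodicOrbit V Γ ∧
  ∃ U : Set (ℝ × ℝ), IsOpen U ∧ Γ ⊆ U ∧
    ∀ Γ' : Set (ℝ × ℝ), IsPeriodicOrbit V Γ' → Γ' ⊆ U → Γ' = Γ

/-- The Liénard vector field `ẋ = y, ẏ = -g(x) - ε f(x) y`. -/
def lienard (f g : Polynomial ℝ) (ε : ℝ) : ℝ × ℝ → ℝ × ℝ :=
  fun p => (p.2, -(g.eval p.1) - ε * (f.eval p.1) * p.2)

/-- `HGe n m c` formalizes `H(n,m) ≥ c`: there are polynomials `f, g` with
`deg f ≤ n`, `deg g ≤ m` and `ε₀ > 0` such that for every `0 < ε ≤ ε₀` the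
Liénard system has at least `c` pairwise distinct limit cycles. -/
def HGe (n m : ℕ) (c : ℝ) : Prop :=
  ∃ f g : Polynomial ℝ, f.natDegree ≤ n ∧ g.natDegree ≤ m ∧
    ∃ ε₀ : ℝ, 0 < ε₀ ∧ ∀ ε : ℝ, 0 < ε → ε ≤ ε₀ →
      ∃ S : Finset (Set (ℝ × ℝ)),
        (∀ Γ ∈ S, IsLimitCycle (lienard f g ε) Γ) ∧ c ≤ (S.card : ℝ)

open scoped Topology

theorem eventually_forall_of_periodic {X : Type*} [TopologicalSpace X] {P : ℝ → X → Prop} {T : ℝ}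
    (hT : 0 < T) (hper : ∀ θ x, P (θ + T) x ↔ P θ x) {x₀ : X}
    (hP : ∀ θ, ∀ᶠ p : ℝ × X in 𝓝 (θ, x₀), P p.1 p.2) : ∀ᶠ x in 𝓝 x₀, ∀ θ, P θ x := by
  have h := (isCompact_Icc (a := (0 : ℝ)) (b := T)).eventually_forall_of_forall_eventually
    (x₀ := x₀) (P := fun x θ => P θ x) (fun θ _ => by
      have := (continuous_swap.tendsto (x₀, θ)).eventually (hP θ)
      exact this)
  filter_upwards [h] with x hx θ
  have hp : Function.Periodic (fun θ => P θ x) T := fun θ => propext (hper θ x)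
  obtain ⟨y, hy, hxy⟩ := hp.exists_mem_Ico₀ hT θ
  have : P θ x = P y x := hxy
  rw [this]
  exact hx y (Set.Ico_subset_Icc_self hy)

theorem fderiv_periodic_fst {X F : Type*} [NormedAddCommGroup X] [NormedSpace ℝ X]
    [NormedAddCommGroup F] [NormedSpace ℝ F] {f : ℝ × X → F} {T : ℝ}
    (hper : ∀ θ q, f (θ + T, q) = f (θ, q)) (θ : ℝ) (q : X) :
    fderiv ℝ f (θ + T, q) = fderiv ℝ f (θ, q) := by
  have h := fderiv_comp_add_right (𝕜 := ℝ) (f := f) (x := (θ, q)) (T, 0)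
  have h2 : (fun x => f (x + (T, 0))) = f := by
    funext x
    obtain ⟨a, b⟩ := x
    simp [hper]
  rw [h2] at h
  simpa using h.symm

theorem odd_parameter_expansion {f : ℝ × ℝ × ℝ × ℝ → ℝ} {T : ℝ} (hT : 0 < T)
    (hper : ∀ θ q, f (θ + T, q) = f (θ, q)) {z : ℝ}
    (hf : ∀ θ, ContDiffAt ℝ 1 f (θ, z, 0, 0))
    (h0 : ∀ θ, fderiv ℝ f (θ, z, 0, 0) (0, 1, 0, 0) = 0) {ε : ℝ} (hε : 0 < ε) :
    ∃ η > 0, ∀ θ p p' l m : ℝ, |p - z| < η → |p' - z| < η → |l| < η → |m| < η →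
      |f (θ, p, l, m) - f (θ, p', l, -m) - 2 * m * fderiv ℝ f (θ, z, 0, 0) (0, 0, 0, 1)|
        ≤ ε * (|p - p'| + 2 * |m|) := by
  have key : ∀ᶠ q : ℝ × ℝ × ℝ in 𝓝 (z, 0, 0), ∀ θ : ℝ,
      DifferentiableAt ℝ f (θ, q) ∧ ‖fderiv ℝ f (θ, q) - fderiv ℝ f (θ, z, 0, 0)‖ < ε := by
    refine eventually_forall_of_periodic hT (fun θ q => ?_) (fun θ => ?_)
    · rw [fderiv_periodic_fst hper, fderiv_periodic_fst hper]
      have : DifferentiableAt ℝ f (θ + T, q) ↔ DifferentiableAt ℝ f (θ, q) := by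
        have h := differentiableAt_comp_add_right (𝕜 := ℝ) (f := f) (x := (θ, q)) (T, 0)
        have h2 : (fun x => f (x + (T, 0))) = f := by
          funext x
          obtain ⟨a, b⟩ := x
          simp [hper]
        rw [h2] at h
        simpa using h.symm
      rw [this]
    · have hd : ∀ᶠ p in 𝓝 ((θ, z, 0, 0) : ℝ × ℝ × ℝ × ℝ), DifferentiableAt ℝ f p :=
        ((hf θ).eventually (by simp)).mono fun p hp => hp.differentiableAt (by simp)
      have hc : ContinuousAt (fderiv ℝ f) (θ, z, 0, 0) :=
        ((hf θ).fderiv_right (m := 0) (by simp)).continuousAt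
      have hc2 : ContinuousAt (fun p : ℝ × ℝ × ℝ × ℝ =>
          ‖fderiv ℝ f (p.1, p.2) - fderiv ℝ f (p.1, z, 0, 0)‖) (θ, z, 0, 0) := by
        refine ContinuousAt.norm (ContinuousAt.sub ?_ ?_)
        · exact hc
        · exact ContinuousAt.comp (g := fderiv ℝ f)
            (f := fun p : ℝ × ℝ × ℝ × ℝ => (p.1, z, (0 : ℝ), (0 : ℝ))) hc (by fun_prop)
      have hlt : ∀ᶠ p in 𝓝 ((θ, z, 0, 0) : ℝ × ℝ × ℝ × ℝ),
          ‖fderiv ℝ f (p.1, p.2) - fderiv ℝ f (p.1, z, 0, 0)‖ < ε :=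
        hc2.eventually_lt continuousAt_const (by simpa using hε)
      exact hd.and hlt
  obtain ⟨η, hη, hball⟩ := Metric.eventually_nhds_iff_ball.1 key
  refine ⟨η, hη, fun θ p p' l m hp hp' hl hm => ?_⟩
  have hmem : ∀ p m : ℝ, |p - z| < η → |m| < η → (p, l, m) ∈ Metric.ball (z, (0 : ℝ), (0 : ℝ)) η := by
    intro p m hp hm
    simp only [Metric.mem_ball, Prod.dist_eq, Real.dist_eq, sub_zero, max_lt_iff]
    exact ⟨hp, hl, hm⟩
  set A := fderiv ℝ f (θ, z, 0, 0) with hA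
  have hmv := (convex_ball (z, (0 : ℝ), (0 : ℝ)) η).norm_image_sub_le_of_norm_hasFDerivWithin_le'
    (𝕜 := ℝ) (f := fun q => f (θ, q))
    (f' := fun q => (fderiv ℝ f (θ, q)).comp (ContinuousLinearMap.inr ℝ ℝ (ℝ × ℝ × ℝ)))
    (φ := A.comp (ContinuousLinearMap.inr ℝ ℝ (ℝ × ℝ × ℝ))) (C := ε)
    (x := (p', l, -m)) (y := (p, l, m))
    (fun q hq => by
      have h1 := (hball q hq θ).1.hasFDerivAt
      have h2 : HasFDerivAt (fun q : ℝ × ℝ × ℝ => (θ, q)) (ContinuousLinearMap.inr ℝ ℝ (ℝ × ℝ × ℝ)) q :=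
        hasFDerivAt_prodMk_right θ q
      exact (h1.comp q h2).hasFDerivWithinAt)
    (fun q hq => by
      rw [← ContinuousLinearMap.sub_comp]
      refine (ContinuousLinearMap.opNorm_comp_le _ _).trans ?_
      calc _ ≤ ε * 1 := by
            gcongr
            · exact (hball q hq θ).2.le
            · exact ContinuousLinearMap.norm_inr_le_one ℝ ℝ (ℝ × ℝ × ℝ)
        _ = ε := mul_one _)
    (hmem p' (-m) hp' (by simpa using hm)) (hmem p m hp hm)
  have e1 : (A.comp (ContinuousLinearMap.inr ℝ ℝ (ℝ × ℝ × ℝ))) ((p, l, m) - (p', l, -m))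
      = 2 * m * A (0, 0, 0, 1) := by
    have : ((0, (p, l, m) - (p', l, -m)) : ℝ × ℝ × ℝ × ℝ)
        = (p - p') • (0, 1, 0, 0) + (2 * m) • (0, 0, 0, 1) := by
      ext <;> simp; ring
    simp only [ContinuousLinearMap.comp_apply, ContinuousLinearMap.inr_apply]
    rw [this, map_add, map_smul, map_smul, h0]
    simp
  have e2 : ‖((p, l, m) - (p', l, -m) : ℝ × ℝ × ℝ)‖ ≤ |p - p'| + 2 * |m| := by
    have h4 : |m + m| = 2 * |m| := by rw [← two_mul, abs_mul]; simp
    simp only [Prod.mk_sub_mk, Prod.norm_def, Real.norm_eq_abs, sub_self, abs_zero, sub_neg_eq_add,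
      h4]
    have := abs_nonneg (p - p')
    have := abs_nonneg m
    refine max_le (by linarith) (max_le (by linarith) (by linarith))
  rw [e1] at hmv
  calc _ ≤ _ := hmv
    _ ≤ _ := by gcongr

/-- The right-hand side `R (θ, h, l, m)` of a scalar equation `h' = R (θ, h, l, m)` which is
`2π`-periodic in `θ`, vanishes for `l = m = 0` and is reversible up to the sign of `m`. -/
structure ReversibleField (R : ℝ × ℝ × ℝ × ℝ → ℝ) (z : ℝ) : Prop where
  contDiffAt : ∀ θ, ContDiffAt ℝ 2 R (θ, z, 0, 0)
  periodic : ∀ θ q, R (θ + 2 * Real.pi, q) = R (θ, q)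
  odd : ∀ θ h l m, R (-θ, h, l, -m) = -R (θ, h, l, m)
  zero : ∀ θ h, R (θ, h, 0, 0) = 0

/-- The first-order coefficient in `m`. -/
noncomputable def mCoeff (R : ℝ × ℝ × ℝ × ℝ → ℝ) (θ h : ℝ) : ℝ :=
  fderiv ℝ R (θ, h, 0, 0) (0, 0, 0, 1)

/-- The partial derivative in `h`. -/
noncomputable def hDeriv (R : ℝ × ℝ × ℝ × ℝ → ℝ) (x : ℝ × ℝ × ℝ × ℝ) : ℝ :=
  fderiv ℝ R x (0, 1, 0, 0)

theorem hasDerivAt_slice_h {f : ℝ × ℝ × ℝ × ℝ → ℝ} {θ h l m : ℝ}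
    (hf : DifferentiableAt ℝ f (θ, h, l, m)) :
    HasDerivAt (fun h => f (θ, h, l, m)) (fderiv ℝ f (θ, h, l, m) (0, 1, 0, 0)) h := by
  have h1 : HasDerivAt (fun h : ℝ => (θ, h, l, m)) ((0 : ℝ), (1 : ℝ), (0 : ℝ), (0 : ℝ)) h :=
    (hasDerivAt_const h θ).prodMk ((hasDerivAt_id h).prodMk
      ((hasDerivAt_const h l).prodMk (hasDerivAt_const h m)))
  exact hf.hasFDerivAt.comp_hasDerivAt h h1

theorem continuous_curve {X : Type*} [TopologicalSpace X] {g : ℝ × ℝ × ℝ × ℝ → X} {z : ℝ}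
    (h : ∀ θ, ContinuousAt g (θ, z, 0, 0)) : Continuous fun θ => g (θ, z, 0, 0) :=
  continuous_iff_continuousAt.2 fun θ => ContinuousAt.comp (g := g)
    (f := fun θ : ℝ => (θ, z, (0 : ℝ), (0 : ℝ))) (h θ) (by fun_prop)

namespace ReversibleField

variable {R : ℝ × ℝ × ℝ × ℝ → ℝ} {z : ℝ}

theorem contDiffAt_hDeriv (hR : ReversibleField R z) (θ : ℝ) :
    ContDiffAt ℝ 1 (hDeriv R) (θ, z, 0, 0) := by
  have := (hR.contDiffAt θ).fderiv_right (m := 1) (by norm_num)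
  exact this.clm_apply contDiffAt_const

theorem hDeriv_periodic (hR : ReversibleField R z) (θ : ℝ) (q : ℝ × ℝ × ℝ) :
    hDeriv R (θ + 2 * Real.pi, q) = hDeriv R (θ, q) := by
  unfold hDeriv
  rw [fderiv_periodic_fst hR.periodic]

theorem eventually_differentiableAt (hR : ReversibleField R z) :
    ∀ᶠ q : ℝ × ℝ × ℝ in 𝓝 (z, 0, 0), ∀ θ : ℝ, ContDiffAt ℝ 2 R (θ, q) := by
  refine eventually_forall_of_periodic Real.two_pi_pos (fun θ q => ?_) (fun θ => ?_)
  · have h2 : (fun x => R (x + (2 * Real.pi, 0))) = R := by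
      funext x
      obtain ⟨a, b⟩ := x
      simp [hR.periodic]
    constructor
    · intro h
      have : ContDiffAt ℝ 2 (fun x => R (x + (2 * Real.pi, 0))) (θ, q) :=
        ContDiffAt.comp (g := R) (f := fun x => x + (2 * Real.pi, 0)) (θ, q) (by simpa using h)
          (by fun_prop)
      rwa [h2] at this
    · intro h
      have h3 : (fun x => R (x - (2 * Real.pi, 0))) = R := by
        funext x
        conv_lhs => rw [← h2]
        simp
      have : ContDiffAt ℝ 2 (fun x => R (x - (2 * Real.pi, 0))) (θ + 2 * Real.pi, q) :=
        ContDiffAt.comp (g := R) (f := fun x => x - (2 * Real.pi, 0)) (θ + 2 * Real.pi, q)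
          (by simpa using h) (by fun_prop)
      rwa [h3] at this
  · exact (hR.contDiffAt θ).eventually (by simp)

theorem hDeriv_zero (hR : ReversibleField R z) (θ h : ℝ)
    (hd : DifferentiableAt ℝ R (θ, h, 0, 0)) : hDeriv R (θ, h, 0, 0) = 0 := by
  have h1 := hasDerivAt_slice_h hd
  have h2 : (fun h => R (θ, h, 0, 0)) = fun _ => 0 := by
    funext h
    exact hR.zero θ h
  rw [h2] at h1
  exact h1.unique (hasDerivAt_const _ _)

theorem eventually_contDiffAt (hR : ReversibleField R z) :
    ∀ᶠ h in 𝓝 z, ∀ θ : ℝ, ContDiffAt ℝ 2 R (θ, h, 0, 0) :=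
  (Continuous.tendsto (f := fun h : ℝ => (h, (0 : ℝ), (0 : ℝ))) (by fun_prop) z).eventually
    hR.eventually_differentiableAt

theorem eventually_reversibleField (hR : ReversibleField R z) :
    ∀ᶠ h in 𝓝 z, ReversibleField R h :=
  hR.eventually_contDiffAt.mono fun _ h => ⟨h, hR.periodic, hR.odd, hR.zero⟩

theorem hDeriv_hDeriv_zero (hR : ReversibleField R z) (θ : ℝ) :
    fderiv ℝ (hDeriv R) (θ, z, 0, 0) (0, 1, 0, 0) = 0 := by
  have h1 := hasDerivAt_slice_h ((hR.contDiffAt_hDeriv θ).differentiableAt (by simp))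
  have h2 : (fun h => hDeriv R (θ, h, 0, 0)) =ᶠ[𝓝 z] fun _ => 0 :=
    hR.eventually_contDiffAt.mono fun h hh =>
      hR.hDeriv_zero θ h ((hh θ).differentiableAt (by simp))
  exact h1.unique ((hasDerivAt_const _ _).congr_of_eventuallyEq h2)

theorem continuous_mCoeff (hR : ReversibleField R z) : Continuous fun θ => mCoeff R θ z := by
  refine continuous_curve (g := fun x => fderiv ℝ R x (0, 0, 0, 1)) fun θ => ?_
  exact (((hR.contDiffAt θ).fderiv_right (m := 1) (by norm_num)).clm_apply
    contDiffAt_const).continuousAt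

theorem continuous_mCoeff_hDeriv (hR : ReversibleField R z) :
    Continuous fun θ => mCoeff (hDeriv R) θ z := by
  refine continuous_curve (g := fun x => fderiv ℝ (hDeriv R) x (0, 0, 0, 1)) fun θ => ?_
  exact (((hR.contDiffAt_hDeriv θ).fderiv_right (m := 0) (by norm_num)).clm_apply
    contDiffAt_const).continuousAt

theorem hasDerivAt_mCoeff (hR : ReversibleField R z) (θ : ℝ) :
    HasDerivAt (fun h => mCoeff R θ h) (mCoeff (hDeriv R) θ z) z := by
  have hc := (hR.contDiffAt θ).fderiv_right (m := 1) (by norm_num)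
  have hd := hc.differentiableAt (by simp)
  have h1 : HasDerivAt (fun h => fderiv ℝ R (θ, h, 0, 0) (0, 0, 0, 1))
      (fderiv ℝ (fun x => fderiv ℝ R x (0, 0, 0, 1)) (θ, z, 0, 0) (0, 1, 0, 0)) z :=
    hasDerivAt_slice_h (f := fun x => fderiv ℝ R x (0, 0, 0, 1))
      (hd.clm_apply (differentiableAt_const _))
  have hsymm : IsSymmSndFDerivAt ℝ R (θ, z, 0, 0) := (hR.contDiffAt θ).isSymmSndFDerivAt (by simp)
  have e1 : ∀ v w, fderiv ℝ (fun x => fderiv ℝ R x v) (θ, z, 0, 0) w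
      = fderiv ℝ (fderiv ℝ R) (θ, z, 0, 0) w v := by
    intro v w
    rw [fderiv_clm_apply hd (differentiableAt_const _)]
    simp
  unfold mCoeff
  convert h1 using 1
  unfold hDeriv
  rw [e1, e1, hsymm.eq]

theorem pair_estimate (hR : ReversibleField R z) {ε : ℝ} (hε : 0 < ε) :
    ∃ η > 0, ∀ θ k h k' h' l m : ℝ, |k - z| < η → |h - z| < η → |k' - z| < η → |h' - z| < η →
      |l| < η → |m| < η → k ≠ h → k' ≠ h' →
      |(R (θ, k, l, m) - R (θ, h, l, m)) / (k - h)
          - (R (θ, k', l, -m) - R (θ, h', l, -m)) / (k' - h') - 2 * m * mCoeff (hDeriv R) θ z|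
        ≤ ε * (|k - k'| + |h - h'| + 2 * |m|) := by
  obtain ⟨η₁, hη₁, hexp⟩ := odd_parameter_expansion Real.two_pi_pos hR.hDeriv_periodic
    hR.contDiffAt_hDeriv hR.hDeriv_hDeriv_zero hε
  obtain ⟨η₂, hη₂, hball⟩ := Metric.eventually_nhds_iff_ball.1 hR.eventually_differentiableAt
  refine ⟨min η₁ η₂, lt_min hη₁ hη₂, ?_⟩
  intro θ k h k' h' l m hk hh hk' hh' hl hm hne hne'
  have hconv : ∀ a b s : ℝ, |a - z| < min η₁ η₂ → |b - z| < min η₁ η₂ → s ∈ Set.Icc (0 : ℝ) 1 →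
      |b + s * (a - b) - z| < min η₁ η₂ := by
    intro a b s ha hb hs
    simpa [Real.dist_eq] using (convex_ball z (min η₁ η₂)).add_smul_sub_mem
      (by simpa [Real.dist_eq] using hb) (by simpa [Real.dist_eq] using ha) hs
  have hd : ∀ p m : ℝ, |p - z| < min η₁ η₂ → |m| < min η₁ η₂ →
      DifferentiableAt ℝ R (θ, p, l, m) := by
    intro p m hp hm
    refine (hball (p, l, m) ?_ θ).differentiableAt (by simp)
    simp only [Metric.mem_ball, Prod.dist_eq, Real.dist_eq, sub_zero, max_lt_iff]
    exact ⟨hp.trans_le (min_le_right _ _), hl.trans_le (min_le_right _ _),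
      hm.trans_le (min_le_right _ _)⟩
  have hslice : ∀ a b m s : ℝ, a ≠ b → |a - z| < min η₁ η₂ → |b - z| < min η₁ η₂ →
      |m| < min η₁ η₂ → s ∈ Set.Icc (0 : ℝ) 1 →
      HasDerivAt (fun s => R (θ, b + s * (a - b), l, m) / (a - b))
        (hDeriv R (θ, b + s * (a - b), l, m)) s := by
    intro a b m s hab ha hb hm hs
    have h1 := hasDerivAt_slice_h (hd _ m (hconv a b s ha hb hs) hm)
    have h2 : HasDerivAt (fun s : ℝ => b + s * (a - b)) (a - b) s := by
      simpa using ((hasDerivAt_id s).mul_const (a - b)).const_add b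
    have h3 := (h1.comp s h2).div_const (a - b)
    refine h3.congr_deriv ?_
    rw [mul_div_assoc, div_self (sub_ne_zero.2 hab), mul_one]
    rfl
  have hm' : |-m| < min η₁ η₂ := by simpa using hm
  obtain ⟨s, hs, hslope⟩ := exists_hasDerivAt_eq_slope
    (fun s => R (θ, h + s * (k - h), l, m) / (k - h)
      - R (θ, h' + s * (k' - h'), l, -m) / (k' - h'))
    (fun s => hDeriv R (θ, h + s * (k - h), l, m) - hDeriv R (θ, h' + s * (k' - h'), l, -m))
    zero_lt_one
    (fun s hs => ((hslice k h m s hne hk hh hm hs).sub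
      (hslice k' h' (-m) s hne' hk' hh' hm' hs)).continuousAt.continuousWithinAt)
    (fun s hs => (hslice k h m s hne hk hh hm (Set.Ioo_subset_Icc_self hs)).sub
      (hslice k' h' (-m) s hne' hk' hh' hm' (Set.Ioo_subset_Icc_self hs)))
  have hsI := Set.Ioo_subset_Icc_self hs
  have hlt : ∀ {x : ℝ}, x < min η₁ η₂ → x < η₁ := fun hx => hx.trans_le (min_le_left _ _)
  have := hexp θ (h + s * (k - h)) (h' + s * (k' - h')) l m (hlt (hconv k h s hk hh hsI))
    (hlt (hconv k' h' s hk' hh' hsI)) (hlt hl) (hlt hm)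
  rw [hslope] at this
  have e : (R (θ, k, l, m) - R (θ, h, l, m)) / (k - h)
      - (R (θ, k', l, -m) - R (θ, h', l, -m)) / (k' - h')
      = (R (θ, h + 1 * (k - h), l, m) / (k - h) - R (θ, h' + 1 * (k' - h'), l, -m) / (k' - h')
        - (R (θ, h + 0 * (k - h), l, m) / (k - h)
          - R (θ, h' + 0 * (k' - h'), l, -m) / (k' - h'))) / (1 - 0) := by
    simp only [one_mul, add_sub_cancel, zero_mul, add_zero, sub_zero, div_one]
    ring
  rw [e]
  refine this.trans ?_
  gcongr
  have e2 : h + s * (k - h) - (h' + s * (k' - h')) = (1 - s) * (h - h') + s * (k - k') := by ring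
  rw [e2]
  obtain ⟨hs0, hs1⟩ := hsI
  calc _ ≤ |(1 - s) * (h - h')| + |s * (k - k')| := abs_add_le _ _
    _ = (1 - s) * |h - h'| + s * |k - k'| := by
        rw [abs_mul, abs_mul, abs_of_nonneg hs0, abs_of_nonneg (sub_nonneg.2 hs1)]
    _ ≤ 1 * |h - h'| + 1 * |k - k'| := by gcongr; linarith
    _ = _ := by ring

end ReversibleField

theorem abs_sub_integral_le {u u' a : ℝ → ℝ} {T D : ℝ} (hT : 0 ≤ T) (ha : Continuous a)
    (hu : ∀ θ ∈ Set.Icc 0 T, HasDerivAt u (u' θ) θ) (hD : ∀ θ ∈ Set.Icc 0 T, |u' θ - a θ| ≤ D) :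
    |u T - u 0 - ∫ θ in (0 : ℝ)..T, a θ| ≤ D * T := by
  have h := norm_image_sub_le_of_norm_deriv_le_segment'
    (f := fun θ => u θ - ∫ s in (0 : ℝ)..θ, a s) (f' := fun θ => u' θ - a θ) (a := 0) (b := T)
    (C := D)
    (fun θ hθ => ((hu θ hθ).sub (ha.integral_hasStrictDerivAt 0 θ).hasDerivAt).hasDerivWithinAt)
    (fun θ hθ => hD θ (Set.Ico_subset_Icc_self hθ)) T ⟨hT, le_rfl⟩
  simp only [intervalIntegral.integral_same, sub_zero, Real.norm_eq_abs] at h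
  convert h using 2
  ring

namespace ReversibleField

variable {R : ℝ × ℝ × ℝ × ℝ → ℝ} {z : ℝ}

theorem fold_hasDerivAt (hR : ReversibleField R z) {k : ℝ → ℝ} {l m θ : ℝ}
    (hθ : θ ∈ Set.Icc 0 Real.pi)
    (hk : ∀ θ ∈ Set.Icc (-Real.pi) Real.pi, HasDerivAt k (R (θ, k θ, l, m)) θ) :
    HasDerivAt k (R (θ, k θ, l, m)) θ ∧
      HasDerivAt (fun θ => k (-θ)) (R (θ, k (-θ), l, -m)) θ := by
  have hpi := Real.pi_pos
  refine ⟨hk θ ⟨by linarith [hθ.1], hθ.2⟩, ?_⟩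
  have h1 := (hk (-θ) ⟨by linarith [hθ.2], by linarith [hθ.1]⟩).scomp θ (hasDerivAt_neg θ)
  refine h1.congr_deriv ?_
  have h2 := hR.odd θ (k (-θ)) l (-m)
  rw [neg_neg] at h2
  rw [h2]
  simp

theorem expansion (hR : ReversibleField R z) {ε : ℝ} (hε : 0 < ε) :
    ∃ η > 0, ∀ θ p p' l m : ℝ, |p - z| < η → |p' - z| < η → |l| < η → |m| < η →
      |R (θ, p, l, m) - R (θ, p', l, -m) - 2 * m * mCoeff R θ z| ≤ ε * (|p - p'| + 2 * |m|) :=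
  odd_parameter_expansion Real.two_pi_pos hR.periodic
    (fun θ => (hR.contDiffAt θ).of_le (by norm_num))
    (fun θ => hR.hDeriv_zero θ z ((hR.contDiffAt θ).differentiableAt (by simp))) hε

theorem exists_fold_bound (hR : ReversibleField R z) :
    ∃ C > 0, ∃ η > 0, ∀ (l m : ℝ) (k : ℝ → ℝ), |l| < η → |m| < η →
      (∀ θ ∈ Set.Icc (-Real.pi) Real.pi, HasDerivAt k (R (θ, k θ, l, m)) θ) →
      (∀ θ ∈ Set.Icc (-Real.pi) Real.pi, |k θ - z| < η) →
      ∀ θ ∈ Set.Icc 0 Real.pi, |k θ - k (-θ)| ≤ C * |m| := by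
  have hpi := Real.pi_pos
  obtain ⟨η, hη, hexp⟩ := hR.expansion one_pos
  obtain ⟨B, hB⟩ := (isCompact_Icc (a := 0) (b := Real.pi)).exists_bound_of_continuousOn
    hR.continuous_mCoeff.continuousOn
  have hB0 : 0 ≤ B := (norm_nonneg _).trans (hB 0 ⟨le_rfl, hpi.le⟩)
  refine ⟨(2 * B + 2) * Real.exp Real.pi, by positivity, η, hη, ?_⟩
  intro l m k hl hm hk hkz θ hθ
  have hderiv : ∀ θ ∈ Set.Icc 0 Real.pi, HasDerivAt (fun θ => k θ - k (-θ))
      (R (θ, k θ, l, m) - R (θ, k (-θ), l, -m)) θ := fun θ hθ =>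
    (hR.fold_hasDerivAt hθ hk).1.sub (hR.fold_hasDerivAt hθ hk).2
  have hg := norm_le_gronwallBound_of_norm_deriv_right_le
    (f := fun θ => k θ - k (-θ)) (f' := fun θ => R (θ, k θ, l, m) - R (θ, k (-θ), l, -m))
    (δ := 0) (K := 1) (ε := (2 * B + 2) * |m|) (a := 0) (b := Real.pi)
    (fun θ hθ => (hderiv θ hθ).continuousAt.continuousWithinAt)
    (fun θ hθ => (hderiv θ (Set.Ico_subset_Icc_self hθ)).hasDerivWithinAt)
    (by simp)
    (fun θ hθ => by
      have hθ' := Set.Ico_subset_Icc_self hθ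
      have h1 := hexp θ (k θ) (k (-θ)) l m (hkz θ ⟨by linarith [hθ.1], hθ.2.le⟩)
        (hkz (-θ) ⟨by linarith [hθ.2], by linarith [hθ.1]⟩) hl hm
      have h2 := hB θ hθ'
      rw [Real.norm_eq_abs] at h2
      have h3 : |2 * m * mCoeff R θ z| ≤ 2 * |m| * B := by
        rw [abs_mul, abs_mul, abs_two]
        gcongr
      have h4 := abs_sub_abs_le_abs_sub (R (θ, k θ, l, m) - R (θ, k (-θ), l, -m))
        (2 * m * mCoeff R θ z)
      simp only [Real.norm_eq_abs]
      linarith) θ hθ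
  rw [Real.norm_eq_abs, gronwallBound_of_K_ne_0 one_ne_zero] at hg
  refine hg.trans ?_
  have h5 : Real.exp (1 * (θ - 0)) ≤ Real.exp Real.pi := Real.exp_le_exp.2 (by linarith [hθ.2])
  have h6 : 0 ≤ (2 * B + 2) * |m| := by positivity
  have h7 := mul_le_mul_of_nonneg_left h5 h6
  simp only [zero_mul, zero_add, div_one]
  linarith

theorem displacement_estimate (hR : ReversibleField R z) {ε : ℝ} (hε : 0 < ε) :
    ∃ η > 0, ∀ (l m : ℝ) (k : ℝ → ℝ), |l| < η → |m| < η →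
      (∀ θ ∈ Set.Icc (-Real.pi) Real.pi, HasDerivAt k (R (θ, k θ, l, m)) θ) →
      (∀ θ ∈ Set.Icc (-Real.pi) Real.pi, |k θ - z| < η) →
      |k Real.pi - k (-Real.pi) - 2 * m * ∫ θ in (0 : ℝ)..Real.pi, mCoeff R θ z| ≤ ε * |m| := by
  have hpi := Real.pi_pos
  obtain ⟨C, hC, η₁, hη₁, hfold⟩ := hR.exists_fold_bound
  have hε' : 0 < ε / ((C + 2) * Real.pi) := by positivity
  obtain ⟨η₂, hη₂, hexp⟩ := hR.expansion hε'
  refine ⟨min η₁ η₂, lt_min hη₁ hη₂, ?_⟩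
  intro l m k hl hm hk hkz
  rw [lt_min_iff] at hl hm
  have hb := hfold l m k hl.1 hm.1 hk fun θ hθ => (hkz θ hθ).trans_le (min_le_left _ _)
  have h := abs_sub_integral_le (u := fun θ => k θ - k (-θ))
    (u' := fun θ => R (θ, k θ, l, m) - R (θ, k (-θ), l, -m))
    (a := fun θ => 2 * m * mCoeff R θ z) (D := ε / ((C + 2) * Real.pi) * ((C + 2) * |m|)) hpi.le
    (continuous_const.mul hR.continuous_mCoeff)
    (fun θ hθ => (hR.fold_hasDerivAt hθ hk).1.sub (hR.fold_hasDerivAt hθ hk).2)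
    (fun θ hθ => by
      refine (hexp θ (k θ) (k (-θ)) l m
        ((hkz θ ⟨by linarith [hθ.1], hθ.2⟩).trans_le (min_le_right _ _))
        ((hkz (-θ) ⟨by linarith [hθ.2], by linarith [hθ.1]⟩).trans_le (min_le_right _ _))
        hl.2 hm.2).trans ?_
      gcongr
      linarith [hb θ hθ])
  rw [intervalIntegral.integral_const_mul] at h
  have e : ε / ((C + 2) * Real.pi) * ((C + 2) * |m|) * Real.pi = ε * |m| := by
    field_simp
  rw [e] at h
  simpa using h

theorem log_separation_estimate (hR : ReversibleField R z) {ε : ℝ} (hε : 0 < ε) :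
    ∃ η > 0, ∀ (l m : ℝ) (k h : ℝ → ℝ), |l| < η → |m| < η →
      (∀ θ ∈ Set.Icc (-Real.pi) Real.pi, HasDerivAt k (R (θ, k θ, l, m)) θ) →
      (∀ θ ∈ Set.Icc (-Real.pi) Real.pi, |k θ - z| < η) →
      (∀ θ ∈ Set.Icc (-Real.pi) Real.pi, HasDerivAt h (R (θ, h θ, l, m)) θ) →
      (∀ θ ∈ Set.Icc (-Real.pi) Real.pi, |h θ - z| < η) →
      (∀ θ ∈ Set.Icc (-Real.pi) Real.pi, k θ ≠ h θ) →
      |Real.log (k Real.pi - h Real.pi) - Real.log (k (-Real.pi) - h (-Real.pi))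
        - 2 * m * ∫ θ in (0 : ℝ)..Real.pi, mCoeff (hDeriv R) θ z| ≤ ε * |m| := by
  have hpi := Real.pi_pos
  obtain ⟨C, hC, η₁, hη₁, hfold⟩ := hR.exists_fold_bound
  have hε' : 0 < ε / ((C + C + 2) * Real.pi) := by positivity
  obtain ⟨η₂, hη₂, hexp⟩ := hR.pair_estimate hε'
  refine ⟨min η₁ η₂, lt_min hη₁ hη₂, ?_⟩
  intro l m k h hl hm hk hkz hh hhz hne
  rw [lt_min_iff] at hl hm
  have hbk := hfold l m k hl.1 hm.1 hk fun θ hθ => (hkz θ hθ).trans_le (min_le_left _ _)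
  have hbh := hfold l m h hl.1 hm.1 hh fun θ hθ => (hhz θ hθ).trans_le (min_le_left _ _)
  have hmem : ∀ θ ∈ Set.Icc 0 Real.pi, θ ∈ Set.Icc (-Real.pi) Real.pi :=
    fun θ hθ => ⟨by linarith [hθ.1], hθ.2⟩
  have hmem' : ∀ θ ∈ Set.Icc 0 Real.pi, -θ ∈ Set.Icc (-Real.pi) Real.pi :=
    fun θ hθ => ⟨by linarith [hθ.2], by linarith [hθ.1]⟩
  have hest := abs_sub_integral_le
    (u := fun θ => Real.log (k θ - h θ) - Real.log (k (-θ) - h (-θ)))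
    (u' := fun θ => (R (θ, k θ, l, m) - R (θ, h θ, l, m)) / (k θ - h θ)
      - (R (θ, k (-θ), l, -m) - R (θ, h (-θ), l, -m)) / (k (-θ) - h (-θ)))
    (a := fun θ => 2 * m * mCoeff (hDeriv R) θ z)
    (D := ε / ((C + C + 2) * Real.pi) * ((C + C + 2) * |m|)) hpi.le
    (continuous_const.mul hR.continuous_mCoeff_hDeriv)
    (fun θ hθ =>
      (((hR.fold_hasDerivAt hθ hk).1.sub (hR.fold_hasDerivAt hθ hh).1).log
          (sub_ne_zero.2 (hne θ (hmem θ hθ)))).sub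
        (((hR.fold_hasDerivAt hθ hk).2.sub (hR.fold_hasDerivAt hθ hh).2).log
          (sub_ne_zero.2 (hne (-θ) (hmem' θ hθ)))))
    (fun θ hθ => by
      refine (hexp θ (k θ) (h θ) (k (-θ)) (h (-θ)) l m
        ((hkz θ (hmem θ hθ)).trans_le (min_le_right _ _))
        ((hhz θ (hmem θ hθ)).trans_le (min_le_right _ _))
        ((hkz (-θ) (hmem' θ hθ)).trans_le (min_le_right _ _))
        ((hhz (-θ) (hmem' θ hθ)).trans_le (min_le_right _ _))
        hl.2 hm.2 (hne θ (hmem θ hθ)) (hne (-θ) (hmem' θ hθ))).trans ?_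
      gcongr
      linarith [hbk θ hθ, hbh θ hθ])
  rw [intervalIntegral.integral_const_mul] at hest
  have e : ε / ((C + C + 2) * Real.pi) * ((C + C + 2) * |m|) * Real.pi = ε * |m| := by
    field_simp
  rw [e] at hest
  simpa using hest

end ReversibleField

theorem exists_flow_of_bounded {f : ℝ → ℝ → ℝ} {L : NNReal} (hlip : ∀ θ, LipschitzWith 1 (f θ))
    (hcont : ∀ x, Continuous fun θ => f θ x) (hbd : ∀ θ x, |f θ x| ≤ L) {c₁ c₂ T : ℝ}
    (hc : c₁ ≤ c₂) (hT : 0 ≤ T) :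
    ∃ α : ℝ → ℝ → ℝ, (∀ c ∈ Set.Icc c₁ c₂, α c 0 = c ∧
      ∀ θ ∈ Set.Ioo (-T) T, HasDerivAt (α c) (f θ (α c θ)) θ) ∧
      ∀ θ ∈ Set.Icc (-T) T, ContinuousOn (fun c => α c θ) (Set.Icc c₁ c₂) := by
  obtain ⟨r, hr⟩ : ∃ r : NNReal, (r : ℝ) = c₂ - c₁ := ⟨⟨c₂ - c₁, sub_nonneg.2 hc⟩, rfl⟩
  obtain ⟨T', rfl⟩ : ∃ T' : NNReal, (T' : ℝ) = T := ⟨⟨T, hT⟩, rfl⟩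
  have hpl : IsPicardLindelof f (tmin := -T') (tmax := T') ⟨0, by simp⟩ c₁ (r + L * T') r L 1 :=
    { lipschitzOnWith := fun θ _ => (hlip θ).lipschitzOnWith
      continuousOn := fun x _ => (hcont x).continuousOn
      norm_le := fun θ _ x _ => hbd θ x
      mul_max_le := by simp }
  obtain ⟨α, hα, L', hL'⟩ :=
    hpl.exists_forall_mem_closedBall_eq_hasDerivWithinAt_lipschitzOnWith
  have hsub : Set.Icc c₁ c₂ ⊆ Metric.closedBall c₁ r := fun c hcc => by
    rw [Metric.mem_closedBall, Real.dist_eq, hr, abs_of_nonneg (sub_nonneg.2 hcc.1)]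
    linarith [hcc.2]
  refine ⟨α, fun c hcc => ⟨(hα c (hsub hcc)).1, fun θ hθ => ?_⟩, fun θ hθ =>
    (hL' θ hθ).continuousOn.mono hsub⟩
  exact ((hα c (hsub hcc)).2 θ (Set.Ioo_subset_Icc_self hθ)).hasDerivAt
    (Icc_mem_nhds hθ.1 hθ.2)

theorem exists_periodic_solution {f : ℝ → ℝ → ℝ} {L : NNReal} (hlip : ∀ θ, LipschitzWith 1 (f θ))
    (hcont : ∀ x, Continuous fun θ => f θ x) (hbd : ∀ θ x, |f θ x| ≤ L)
    (hper : ∀ θ x, f (θ + 2 * Real.pi) x = f θ x) {c₁ c₂ : ℝ} (hc : c₁ ≤ c₂)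
    (hsign : ∀ k₁ k₂ : ℝ → ℝ, k₁ 0 = c₁ → k₂ 0 = c₂ →
      (∀ θ ∈ Set.Icc (-Real.pi) Real.pi, HasDerivAt k₁ (f θ (k₁ θ)) θ) →
      (∀ θ ∈ Set.Icc (-Real.pi) Real.pi, HasDerivAt k₂ (f θ (k₂ θ)) θ) →
      (k₁ Real.pi - k₁ (-Real.pi)) * (k₂ Real.pi - k₂ (-Real.pi)) ≤ 0) :
    ∃ h : ℝ → ℝ, Function.Periodic h (2 * Real.pi) ∧ (∀ θ, HasDerivAt h (f θ (h θ)) θ) ∧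
      h 0 ∈ Set.Icc c₁ c₂ := by
  have hpi := Real.pi_pos
  obtain ⟨α, hα, hαc⟩ := exists_flow_of_bounded hlip hcont hbd hc
    (T := 4 * Real.pi) (by positivity)
  have hsol : ∀ c ∈ Set.Icc c₁ c₂, ∀ θ ∈ Set.Icc (-Real.pi) Real.pi,
      HasDerivAt (α c) (f θ (α c θ)) θ := fun c hcc θ hθ =>
    (hα c hcc).2 θ ⟨by linarith [hθ.1], by linarith [hθ.2]⟩
  have hl : c₁ ∈ Set.Icc c₁ c₂ := ⟨le_rfl, hc⟩
  have hr : c₂ ∈ Set.Icc c₁ c₂ := ⟨hc, le_rfl⟩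
  have hs := hsign (α c₁) (α c₂) (hα c₁ hl).1 (hα c₂ hr).1 (hsol c₁ hl) (hsol c₂ hr)
  have hdc : ContinuousOn (fun c => α c Real.pi - α c (-Real.pi)) (Set.Icc c₁ c₂) :=
    (hαc _ ⟨by linarith, by linarith⟩).sub (hαc _ ⟨by linarith, by linarith⟩)
  obtain ⟨c, hcI, hc0⟩ : ∃ c ∈ Set.Icc c₁ c₂, α c Real.pi - α c (-Real.pi) = 0 := by
    rcases mul_nonpos_iff.1 hs with ⟨h1, h2⟩ | ⟨h1, h2⟩
    · exact intermediate_value_Icc' hc hdc ⟨h2, h1⟩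
    · exact intermediate_value_Icc hc hdc ⟨h1, h2⟩
  set a := α c with ha
  have hd : ∀ θ ∈ Set.Ioo (-(4 * Real.pi)) (4 * Real.pi), HasDerivAt a (f θ (a θ)) θ :=
    (hα c hcI).2
  have hshift : ∀ θ ∈ Set.Ioo (-(2 * Real.pi)) (2 * Real.pi), a (θ + 2 * Real.pi) = a θ := by
    have := ODE_solution_unique_of_mem_Ioo (v := f) (s := fun _ => Set.univ) (K := 1)
      (f := fun θ => a (θ + 2 * Real.pi)) (g := a) (a := -(2 * Real.pi)) (b := 2 * Real.pi)
      (t₀ := -Real.pi) (fun t _ => (hlip t).lipschitzOnWith)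
      ⟨by linarith, by linarith⟩
      (fun t ht => ⟨by
        have h1 := (hd (t + 2 * Real.pi) ⟨by linarith [ht.1], by linarith [ht.2]⟩).comp_add_const
          t (2 * Real.pi)
        rwa [hper] at h1, trivial⟩)
      (fun t ht => ⟨hd t ⟨by linarith [ht.1], by linarith [ht.2]⟩, trivial⟩)
      (by
        have e : -Real.pi + 2 * Real.pi = Real.pi := by ring
        simp only [e]
        linarith)
    exact this
  have hp2 := Real.two_pi_pos
  refine ⟨fun θ => a (toIcoMod hp2 (-Real.pi) θ), ?_, ?_, ?_⟩
  · intro θ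
    exact congrArg a (toIcoMod_periodic hp2 (-Real.pi) θ)
  · intro θ₀
    set n := toIcoDiv hp2 (-Real.pi) θ₀ with hn
    have hs0 := toIcoMod_mem_Ico hp2 (-Real.pi) θ₀
    have es0 : toIcoMod hp2 (-Real.pi) θ₀ = θ₀ - n * (2 * Real.pi) := by
      rw [← self_sub_toIcoDiv_zsmul, zsmul_eq_mul]
    have hfper : Function.Periodic (fun θ => f θ (a (toIcoMod hp2 (-Real.pi) θ₀)))
      (2 * Real.pi) := fun θ => hper θ _
    have hnhds : ∀ᶠ θ in 𝓝 θ₀, θ - n * (2 * Real.pi) ∈ Set.Ioo (-(2 * Real.pi)) Real.pi := by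
      refine (Continuous.tendsto (by fun_prop) θ₀).eventually (Ioo_mem_nhds ?_ ?_)
      · rw [← es0]; linarith [hs0.1]
      · rw [← es0]; linarith [hs0.2]
    have heq : (fun θ => a (toIcoMod hp2 (-Real.pi) θ)) =ᶠ[𝓝 θ₀]
        fun θ => a (θ - n * (2 * Real.pi)) := by
      filter_upwards [hnhds] with θ hθ
      rcases le_or_gt (-Real.pi) (θ - n * (2 * Real.pi)) with h | h
      · congr 1
        rw [toIcoMod_eq_iff]
        refine ⟨⟨h, by linarith [hθ.2]⟩, n, ?_⟩
        rw [zsmul_eq_mul]; ring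
      · have e : toIcoMod hp2 (-Real.pi) θ = θ - n * (2 * Real.pi) + 2 * Real.pi := by
          rw [toIcoMod_eq_iff]
          refine ⟨⟨by linarith [hθ.1], by linarith [hθ.1]⟩, n - 1, ?_⟩
          rw [zsmul_eq_mul]; push_cast; ring
        rw [e, hshift _ ⟨hθ.1, by linarith [hθ.2]⟩]
    have h1 := (hd _ ⟨by linarith [hs0.1], by linarith [hs0.2]⟩ :
      HasDerivAt a (f (toIcoMod hp2 (-Real.pi) θ₀) (a (toIcoMod hp2 (-Real.pi) θ₀)))
        (toIcoMod hp2 (-Real.pi) θ₀))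
    have e2 : f (toIcoMod hp2 (-Real.pi) θ₀) (a (toIcoMod hp2 (-Real.pi) θ₀))
        = f θ₀ (a (toIcoMod hp2 (-Real.pi) θ₀)) := by
      have := hfper.sub_int_mul_eq n (x := θ₀)
      rw [← es0] at this
      exact this
    rw [e2] at h1
    rw [es0] at h1
    refine ((h1.comp_sub_const θ₀ _).congr_of_eventuallyEq heq).congr_deriv ?_
    simp only [es0]
  · have e : toIcoMod hp2 (-Real.pi) 0 = 0 := by
      rw [toIcoMod_eq_iff]
      exact ⟨⟨by linarith, by linarith⟩, 0, by simp⟩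
    simp only [e]
    rw [ha, (hα c hcI).1]
    exact hcI

theorem eq_zero_of_abs_sub_le_of_bddAbove {w : ℤ → ℝ} {s B : ℝ} (hB : ∀ n, w n ≤ B)
    (hw : ∀ n, |w n - w (n - 1) - s| ≤ |s| / 2) : s = 0 := by
  by_contra hs
  have hs0 : 0 < |s| := abs_pos.2 hs
  have key : ∀ n : ℕ, ∃ i : ℤ, w 0 + n * (|s| / 2) ≤ w i := by
    rcases lt_or_gt_of_ne hs with h | h
    · have : ∀ n : ℕ, w 0 + n * (|s| / 2) ≤ w (-n) := by
        intro n
        induction n with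
        | zero => simp
        | succ n ih =>
          have h1 := (abs_le.1 (hw (-n))).2
          have e : (-((n + 1 : ℕ) : ℤ)) = -(n : ℤ) - 1 := by push_cast; ring
          rw [e]
          rw [abs_of_neg h] at *
          push_cast
          linarith
      exact fun n => ⟨_, this n⟩
    · have : ∀ n : ℕ, w 0 + n * (|s| / 2) ≤ w n := by
        intro n
        induction n with
        | zero => simp
        | succ n ih =>
          have h1 := (abs_le.1 (hw (n + 1))).1
          rw [add_sub_cancel_right] at h1
          rw [abs_of_pos h] at *
          push_cast
          linarith
      exact fun n => ⟨_, this n⟩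
  obtain ⟨n, hn⟩ := exists_nat_gt ((B - w 0) / (|s| / 2))
  rw [div_lt_iff₀ (by positivity)] at hn
  obtain ⟨i, hi⟩ := key n
  linarith [hB i]

namespace ReversibleField

variable {R : ℝ × ℝ × ℝ × ℝ → ℝ} {z : ℝ}

theorem periodic_int (hR : ReversibleField R z) (θ : ℝ) (q : ℝ × ℝ × ℝ) (n : ℤ) :
    R (θ + n * (2 * Real.pi), q) = R (θ, q) := by
  have : Function.Periodic (fun θ => R (θ, q)) (2 * Real.pi) := fun θ => hR.periodic θ q
  exact this.int_mul n θ

/-- Uniform control of `R` near the curve `h = z`, `l = m = 0`. -/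
theorem exists_uniform_bounds (hR : ReversibleField R z) :
    ∃ C > 0, ∃ η > 0, ∀ θ h l m : ℝ, |h - z| < η → |l| < η → |m| < η →
      ContDiffAt ℝ 2 R (θ, h, l, m) ∧ ‖fderiv ℝ R (θ, h, l, m)‖ ≤ C ∧
        |hDeriv R (θ, h, l, m)| ≤ 1 := by
  have hfc : ∀ θ, ContinuousAt (fderiv ℝ R) (θ, z, 0, 0) := fun θ =>
    ((hR.contDiffAt θ).fderiv_right (m := 1) (by norm_num)).continuousAt
  have hcont : Continuous fun θ => ‖fderiv ℝ R (θ, z, 0, 0)‖ :=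
    (continuous_curve hfc).norm
  obtain ⟨C, hC⟩ := (isCompact_Icc (a := 0) (b := 2 * Real.pi)).exists_bound_of_continuousOn
    hcont.continuousOn
  have hC' : ∀ θ, ‖fderiv ℝ R (θ, z, 0, 0)‖ ≤ C := by
    intro θ
    have hp : Function.Periodic (fun θ => ‖fderiv ℝ R (θ, z, 0, 0)‖) (2 * Real.pi) := fun θ => by
      simp only [fderiv_periodic_fst hR.periodic]
    obtain ⟨y, hy, hxy⟩ := hp.exists_mem_Ico₀ Real.two_pi_pos θ
    have := hC y (Set.Ico_subset_Icc_self hy)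
    rw [norm_norm] at this
    exact hxy.trans_le this
  have hC0 : 0 ≤ C := (norm_nonneg _).trans (hC' 0)
  have h1 : ∀ᶠ q : ℝ × ℝ × ℝ in 𝓝 (z, 0, 0), ∀ θ : ℝ, ‖fderiv ℝ R (θ, q)‖ ≤ C + 1 := by
    refine eventually_forall_of_periodic Real.two_pi_pos
      (fun θ q => by rw [fderiv_periodic_fst hR.periodic]) fun θ => ?_
    have := (hfc θ).norm.tendsto.eventually_lt_const (u := C + 1) (by linarith [hC' θ])
    exact this.mono fun p hp => hp.le
  have h2 : ∀ᶠ q : ℝ × ℝ × ℝ in 𝓝 (z, 0, 0), ∀ θ : ℝ, |hDeriv R (θ, q)| ≤ 1 := by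
    refine eventually_forall_of_periodic Real.two_pi_pos
      (fun θ q => by rw [hR.hDeriv_periodic]) fun θ => ?_
    have := (hR.contDiffAt_hDeriv θ).continuousAt.abs.tendsto.eventually_lt_const (u := 1) (by
      rw [hR.hDeriv_zero θ z ((hR.contDiffAt θ).differentiableAt (by simp))]
      simp)
    exact this.mono fun p hp => hp.le
  obtain ⟨η, hη, hb⟩ := Metric.eventually_nhds_iff_ball.1
    (hR.eventually_differentiableAt.and (h1.and h2))
  refine ⟨C + 1, by linarith, η, hη, fun θ h l m hh hl hm => ?_⟩
  have hq : (h, l, m) ∈ Metric.ball (z, (0 : ℝ), (0 : ℝ)) η := by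
    simp only [Metric.mem_ball, Prod.dist_eq, Real.dist_eq, sub_zero, max_lt_iff]
    exact ⟨hh, hl, hm⟩
  obtain ⟨a, b, c⟩ := hb _ hq
  exact ⟨a θ, b θ, c θ⟩

theorem hasDerivAt_integral_mCoeff (hR : ReversibleField R z) :
    HasDerivAt (fun h => ∫ θ in (0 : ℝ)..Real.pi, mCoeff R θ h)
      (∫ θ in (0 : ℝ)..Real.pi, mCoeff (hDeriv R) θ z) z := by
  have hc : ∀ θ, ContinuousAt (fun x => fderiv ℝ (hDeriv R) x (0, 0, 0, 1)) (θ, z, 0, 0) :=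
    fun θ => (((hR.contDiffAt_hDeriv θ).fderiv_right (m := 0) (by norm_num)).clm_apply
      contDiffAt_const).continuousAt
  obtain ⟨C, hC⟩ := (isCompact_Icc (a := 0) (b := 2 * Real.pi)).exists_bound_of_continuousOn
    hR.continuous_mCoeff_hDeriv.continuousOn
  have hC' : ∀ θ, ‖mCoeff (hDeriv R) θ z‖ ≤ C := by
    intro θ
    have hp : Function.Periodic (fun θ => mCoeff (hDeriv R) θ z) (2 * Real.pi) := fun θ => by
      unfold mCoeff
      simp only [fderiv_periodic_fst hR.hDeriv_periodic]
    obtain ⟨y, hy, hxy⟩ := hp.exists_mem_Ico₀ Real.two_pi_pos θ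
    have := hC y (Set.Ico_subset_Icc_self hy)
    exact hxy ▸ this
  have h1 : ∀ᶠ q : ℝ × ℝ × ℝ in 𝓝 (z, 0, 0), ∀ θ : ℝ,
      ‖fderiv ℝ (hDeriv R) (θ, q) (0, 0, 0, 1)‖ ≤ C + 1 := by
    refine eventually_forall_of_periodic Real.two_pi_pos
      (fun θ q => by rw [fderiv_periodic_fst hR.hDeriv_periodic]) fun θ => ?_
    have := (hc θ).norm.tendsto.eventually_lt_const (u := C + 1) (by
      have := hC' θ
      unfold mCoeff at this
      linarith)
    exact this.mono fun p hp => hp.le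
  have h2 : ∀ᶠ h in 𝓝 z, ∀ θ : ℝ, ‖mCoeff (hDeriv R) θ h‖ ≤ C + 1 :=
    (Continuous.tendsto (f := fun h : ℝ => (h, (0 : ℝ), (0 : ℝ))) (by fun_prop) z).eventually h1
  refine (intervalIntegral.hasDerivAt_integral_of_dominated_loc_of_deriv_le
    (bound := fun _ => C + 1) (F' := fun h θ => mCoeff (hDeriv R) θ h)
    (h2.and hR.eventually_reversibleField) ?_
    (hR.continuous_mCoeff.intervalIntegrable _ _)
    hR.continuous_mCoeff_hDeriv.aestronglyMeasurable ?_ (by simp) ?_).2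
  · exact hR.eventually_reversibleField.mono fun h hh => hh.continuous_mCoeff.aestronglyMeasurable
  · exact Eventually.of_forall fun θ _ h hh => hh.1 θ
  · exact Eventually.of_forall fun θ _ h hh => hh.2.hasDerivAt_mCoeff θ

end ReversibleField

theorem abs_sub_initial_le {k k' : ℝ → ℝ} {L : ℝ}
    (hk : ∀ θ ∈ Set.Icc (-Real.pi) Real.pi, HasDerivAt k (k' θ) θ)
    (hL : ∀ θ ∈ Set.Icc (-Real.pi) Real.pi, |k' θ| ≤ L) :
    ∀ θ ∈ Set.Icc (-Real.pi) Real.pi, |k θ - k 0| ≤ L * Real.pi := by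
  intro θ hθ
  have hpi := Real.pi_pos
  have h0 : (0 : ℝ) ∈ Set.Icc (-Real.pi) Real.pi := ⟨by linarith, hpi.le⟩
  have h := (convex_Icc (-Real.pi) Real.pi).norm_image_sub_le_of_norm_hasDerivWithin_le
    (fun θ hθ => (hk θ hθ).hasDerivWithinAt) hL h0 hθ
  rw [Real.norm_eq_abs, Real.norm_eq_abs, sub_zero] at h
  refine h.trans ?_
  have : 0 ≤ L := (abs_nonneg _).trans (hL 0 h0)
  gcongr
  exact abs_le.2 hθ

theorem exists_sign_change {M : ℝ → ℝ} {M' z : ℝ} (hM : HasDerivAt M M' z) (h0 : M z = 0)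
    (hM' : M' ≠ 0) : ∃ δ > 0, ∀ c, 0 < c → c < δ → M (z - c) * M (z + c) < 0 := by
  have h1 := (hasDerivAt_iff_tendsto_slope.1 hM).mul_const M'
  have h2 := h1.eventually (lt_mem_nhds (mul_self_pos.2 hM'))
  rw [eventually_nhdsWithin_iff] at h2
  obtain ⟨δ, hδ, hb⟩ := Metric.eventually_nhds_iff_ball.1 h2
  refine ⟨δ, hδ, fun c hc hcδ => ?_⟩
  have ha := hb (z - c) (by simp [abs_of_pos hc, hcδ]) (by simp [hc.ne'])
  have hb' := hb (z + c) (by simp [abs_of_pos hc, hcδ]) (by simp [hc.ne'])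
  rw [slope_def_field, h0] at ha hb'
  have e1 : z - c - z = -c := by ring
  have e2 : z + c - z = c := by ring
  rw [e1, sub_zero] at ha
  rw [e2, sub_zero] at hb'
  have h3 : 0 < (M (z - c) / -c * M') * (M (z + c) / c * M') := mul_pos ha hb'
  have e : (M (z - c) / -c * M') * (M (z + c) / c * M')
      = -(M (z - c) * M (z + c)) * (M' ^ 2 / c ^ 2) := by
    field_simp
  rw [e] at h3
  have h4 : 0 < M' ^ 2 / c ^ 2 := by positivity
  have := pos_of_mul_pos_left h3 h4.le
  linarith

theorem exists_lt_of_pos (C μ : ℝ) (hC : 0 < C) (hμ : 0 < μ) :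
    ∃ ε > 0, ε < μ ∧ C * ε < μ := by
  refine ⟨μ / (2 * (1 + C)), by positivity, ?_, ?_⟩
  · rw [div_lt_iff₀ (by positivity)]
    nlinarith
  · rw [← mul_div_assoc, div_lt_iff₀ (by positivity)]
    nlinarith

namespace ReversibleField

variable {R : ℝ × ℝ × ℝ × ℝ → ℝ} {z : ℝ}

theorem exists_lipschitz_bounds (hR : ReversibleField R z) :
    ∃ C > 0, ∃ η > 0, ∀ l m : ℝ, |l| < η → |m| < η →
      (∀ θ, LipschitzOnWith 1 (fun h => R (θ, h, l, m)) (Metric.ball z η)) ∧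
      (∀ h ∈ Metric.ball z η, Continuous fun θ => R (θ, h, l, m)) ∧
      ∀ θ, ∀ h ∈ Metric.ball z η, |R (θ, h, l, m)| ≤ C * max |l| |m| := by
  obtain ⟨C, hC, η, hη, hb⟩ := hR.exists_uniform_bounds
  refine ⟨C, hC, η, hη, fun l m hl hm => ⟨fun θ => ?_, fun h hh => ?_, fun θ h hh => ?_⟩⟩
  · refine (convex_ball z η).lipschitzOnWith_of_nnnorm_hasDerivWithin_le (𝕜 := ℝ)
      (f' := fun h => hDeriv R (θ, h, l, m)) (fun h hh => ?_) (fun h hh => ?_)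
    · exact (hasDerivAt_slice_h
        ((hb θ h l m (by simpa [Real.dist_eq] using hh) hl hm).1.differentiableAt
          (by simp))).hasDerivWithinAt
    · have := (hb θ h l m (by simpa [Real.dist_eq] using hh) hl hm).2.2
      rw [← NNReal.coe_le_coe]
      simpa using this
  · refine continuous_iff_continuousAt.2 fun θ => ?_
    exact ContinuousAt.comp (g := R) (f := fun θ : ℝ => (θ, h, l, m))
      (hb θ h l m (by simpa [Real.dist_eq] using hh) hl hm).1.continuousAt (by fun_prop)
  · have hmem : ∀ s ∈ Metric.ball (0 : ℝ × ℝ) η, |s.1| < η ∧ |s.2| < η := by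
      intro s hs
      simpa [Prod.norm_def] using hs
    have h1 := (convex_ball (0 : ℝ × ℝ) η).norm_image_sub_le_of_norm_hasFDerivWithin_le
      (f := fun s : ℝ × ℝ => R (θ, h, s))
      (f' := fun s => (fderiv ℝ R (θ, h, s)).comp
        ((0 : ℝ × ℝ →L[ℝ] ℝ).prod ((0 : ℝ × ℝ →L[ℝ] ℝ).prod (ContinuousLinearMap.id ℝ (ℝ × ℝ))))) (C := C) (x := 0) (y := (l, m))
      (fun s hs => by
        have hs' := hmem s hs
        have hd := (hb θ h s.1 s.2 (by simpa [Real.dist_eq] using hh) hs'.1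
          hs'.2).1.differentiableAt (by simp)
        have hi : HasFDerivAt (fun s : ℝ × ℝ => (θ, h, s))
            ((0 : ℝ × ℝ →L[ℝ] ℝ).prod ((0 : ℝ × ℝ →L[ℝ] ℝ).prod (ContinuousLinearMap.id ℝ (ℝ × ℝ)))) s :=
          (hasFDerivAt_const θ s).prodMk
            ((hasFDerivAt_const h s).prodMk (hasFDerivAt_id (𝕜 := ℝ) s))
        exact (HasFDerivAt.comp s (g := R) hd.hasFDerivAt hi).hasFDerivWithinAt)
      (fun s hs => by
        have hs' := hmem s hs
        have hd := (hb θ h s.1 s.2 (by simpa [Real.dist_eq] using hh) hs'.1 hs'.2).2.1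
        refine (ContinuousLinearMap.opNorm_comp_le _ _).trans ?_
        have hn : ‖((0 : ℝ × ℝ →L[ℝ] ℝ).prod ((0 : ℝ × ℝ →L[ℝ] ℝ).prod (ContinuousLinearMap.id ℝ (ℝ × ℝ))))‖ ≤ 1 := by
          refine ContinuousLinearMap.opNorm_le_bound _ zero_le_one fun x => ?_
          simp [Prod.norm_def]
        calc _ ≤ C * 1 := by
              gcongr
          _ = C := mul_one C)
      (by simpa using hη) (by simp [Prod.norm_def, hl, hm])
    have e0 : R (θ, h, (0 : ℝ × ℝ)) = 0 := hR.zero θ h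
    rw [e0, sub_zero, sub_zero] at h1
    simpa [Prod.norm_def] using h1

end ReversibleField

namespace ReversibleField

variable {R : ℝ × ℝ × ℝ × ℝ → ℝ} {z : ℝ}

/-- Near a simple zero of the averaged function two solutions staying close to `z` coincide. -/
theorem exists_unique_bounded_solution (hR : ReversibleField R z)
    (hM' : ∫ θ in (0 : ℝ)..Real.pi, mCoeff (hDeriv R) θ z ≠ 0) :
    ∃ η > 0, ∀ (l m : ℝ) (k h : ℝ → ℝ), |l| < η → |m| < η → m ≠ 0 →
      (∀ θ, HasDerivAt k (R (θ, k θ, l, m)) θ) → (∀ θ, |k θ - z| < η) →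
      (∀ θ, HasDerivAt h (R (θ, h θ, l, m)) θ) → (∀ θ, |h θ - z| < η) → k = h := by
  obtain ⟨C, -, η₁, hη₁, hlip⟩ := hR.exists_lipschitz_bounds
  obtain ⟨η₂, hη₂, hlog⟩ := hR.log_separation_estimate (abs_pos.2 hM')
  refine ⟨min η₁ η₂, lt_min hη₁ hη₂, fun l m k h hl hm hm0 hk hkz hh hhz => ?_⟩
  simp only [lt_min_iff] at hl hm hkz hhz
  by_cases hmeet : ∃ θ, k θ = h θ
  · obtain ⟨θ₀, hθ₀⟩ := hmeet
    exact ODE_solution_unique_univ (v := fun θ h => R (θ, h, l, m))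
      (s := fun _ => Metric.ball z η₁) (hlip l m hl.1 hm.1).1
      (fun θ => ⟨hk θ, by simpa [Real.dist_eq] using (hkz θ).1⟩)
      (fun θ => ⟨hh θ, by simpa [Real.dist_eq] using (hhz θ).1⟩) hθ₀
  · push Not at hmeet
    exfalso
    set M' := ∫ θ in (0 : ℝ)..Real.pi, mCoeff (hDeriv R) θ z with hMdef
    set w : ℤ → ℝ := fun n => Real.log (k (Real.pi + n * (2 * Real.pi))
      - h (Real.pi + n * (2 * Real.pi))) with hw
    have hshift : ∀ (n : ℤ) (f : ℝ → ℝ), (∀ θ, HasDerivAt f (R (θ, f θ, l, m)) θ) →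
        ∀ θ, HasDerivAt (fun θ => f (θ + n * (2 * Real.pi)))
          (R (θ, f (θ + n * (2 * Real.pi)), l, m)) θ := by
      intro n f hf θ
      have := (hf (θ + n * (2 * Real.pi))).comp_add_const θ _
      rwa [hR.periodic_int] at this
    have hs0 := eq_zero_of_abs_sub_le_of_bddAbove (w := w) (s := 2 * m * M')
      (B := Real.log (2 * η₁)) (fun n => ?_) (fun n => ?_)
    · have : 2 * m * M' ≠ 0 := by positivity
      exact this hs0
    · rw [hw]
      simp only
      rw [← Real.log_abs]
      refine Real.log_le_log (abs_pos.2 (sub_ne_zero.2 (hmeet _))) ?_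
      have h1 := (hkz (Real.pi + n * (2 * Real.pi))).1
      have h2 := (hhz (Real.pi + n * (2 * Real.pi))).1
      rw [abs_lt] at h1 h2
      rw [abs_le]
      constructor <;> linarith [h1.1, h1.2, h2.1, h2.2]
    · have h1 := hlog l m _ _ hl.2 hm.2 (fun θ _ => hshift n k hk θ) (fun θ _ => (hkz _).2)
        (fun θ _ => hshift n h hh θ) (fun θ _ => (hhz _).2) (fun θ _ => hmeet _)
      have e : -Real.pi + (n : ℝ) * (2 * Real.pi)
          = Real.pi + ((n - 1 : ℤ) : ℝ) * (2 * Real.pi) := by push_cast; ring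
      rw [e] at h1
      refine h1.trans (le_of_eq ?_)
      rw [abs_mul, abs_mul, abs_two]
      ring

/-- A simple zero of the averaged function yields a periodic solution. -/
theorem exists_periodic_near (hR : ReversibleField R z)
    (hM : ∫ θ in (0 : ℝ)..Real.pi, mCoeff R θ z = 0)
    (hM' : ∫ θ in (0 : ℝ)..Real.pi, mCoeff (hDeriv R) θ z ≠ 0) :
    ∃ η₀ > 0, ∀ η, 0 < η → η ≤ η₀ → ∃ ε₀ > 0, ∀ l m : ℝ, |l| ≤ ε₀ → m ≠ 0 → |m| ≤ ε₀ →
      ∃ h : ℝ → ℝ, Function.Periodic h (2 * Real.pi) ∧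
        (∀ θ, HasDerivAt h (R (θ, h θ, l, m)) θ) ∧ ∀ θ, |h θ - z| < η := by
  have hpi := Real.pi_pos
  obtain ⟨C, hC, ηb, hηb, hlip⟩ := hR.exists_lipschitz_bounds
  refine ⟨ηb, hηb, fun η hη hηle => ?_⟩
  obtain ⟨δ₁, hδ₁, hsgn⟩ := exists_sign_change hR.hasDerivAt_integral_mCoeff hM hM'
  obtain ⟨δ₂, hδ₂, hrev⟩ := Metric.eventually_nhds_iff_ball.1 hR.eventually_reversibleField
  obtain ⟨c, hc, hcδ₁, hcδ₂, hcη⟩ : ∃ c > 0, c < δ₁ ∧ c < δ₂ ∧ c < η / 4 := by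
    obtain ⟨c, hc, hc'⟩ := exists_between
      (lt_min hδ₁ (lt_min hδ₂ (show 0 < η / 4 by positivity)))
    exact ⟨c, hc, (lt_min_iff.1 hc').1, (lt_min_iff.1 (lt_min_iff.1 hc').2).1,
      (lt_min_iff.1 (lt_min_iff.1 hc').2).2⟩
  have hprod := hsgn c hc hcδ₁
  set M : ℝ → ℝ := fun h => ∫ θ in (0 : ℝ)..Real.pi, mCoeff R θ h with hMdef
  have hM1 : M (z - c) ≠ 0 := left_ne_zero_of_mul hprod.ne
  have hM2 : M (z + c) ≠ 0 := right_ne_zero_of_mul hprod.ne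
  obtain ⟨η₁, hη₁, hd₁⟩ := (hrev (z - c) (by simp [abs_of_pos hc, hcδ₂])).displacement_estimate
    (abs_pos.2 hM1)
  obtain ⟨η₂, hη₂, hd₂⟩ := (hrev (z + c) (by simp [abs_of_pos hc, hcδ₂])).displacement_estimate
    (abs_pos.2 hM2)
  obtain ⟨ε₀, hε₀, hε₁, hε₂⟩ := exists_lt_of_pos (C * Real.pi) (min (min η₁ η₂) (η / 4))
    (by positivity) (lt_min (lt_min hη₁ hη₂) (by positivity))
  simp only [lt_min_iff] at hε₁ hε₂
  obtain ⟨⟨hε₁₁, hε₁₂⟩, hε₁₃⟩ := hε₁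
  obtain ⟨⟨hε₂₁, hε₂₂⟩, hε₂₃⟩ := hε₂
  refine ⟨ε₀, hε₀, fun l m hl hm0 hm => ?_⟩
  obtain ⟨hL1, hL2, hL3⟩ := hlip l m (by linarith) (by linarith)
  have hz : z - η / 2 ≤ z + η / 2 := by linarith
  set pr : ℝ → ℝ := fun x => (Set.projIcc (z - η / 2) (z + η / 2) hz x : ℝ) with hpr
  have hprmem : ∀ x, pr x ∈ Metric.ball z ηb := fun x => by
    have := (Set.projIcc (z - η / 2) (z + η / 2) hz x).2
    rw [Metric.mem_ball, Real.dist_eq, abs_lt]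
    constructor <;> simp only [hpr] <;> linarith [this.1, this.2]
  have hpreq : ∀ x, |x - z| < η / 2 → pr x = x := fun x hx => by
    rw [abs_lt] at hx
    simp only [hpr]
    rw [Set.projIcc_of_mem hz ⟨by linarith, by linarith⟩]
  have hprlip : LipschitzWith 1 pr := by
    have := LipschitzWith.subtype_val (Set.Icc (z - η / 2) (z + η / 2)) |>.comp
      (LipschitzWith.projIcc hz)
    rw [one_mul] at this
    exact this
  set f : ℝ → ℝ → ℝ := fun θ x => R (θ, pr x, l, m) with hf
  obtain ⟨L, hL⟩ : ∃ L : NNReal, (L : ℝ) = C * ε₀ := ⟨⟨C * ε₀, by positivity⟩, rfl⟩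
  have hbd : ∀ θ x, |f θ x| ≤ L := fun θ x => by
    rw [hL]
    refine (hL3 θ (pr x) (hprmem x)).trans ?_
    gcongr
    exact max_le hl hm
  have hLpi : L * Real.pi = C * Real.pi * ε₀ := by rw [hL]; ring
  have hflip : ∀ θ, LipschitzWith 1 (f θ) := fun θ => by
    have := (hL1 θ).comp (hprlip.lipschitzOnWith (s := Set.univ)) (fun x _ => hprmem x)
    rw [one_mul, lipschitzOnWith_univ] at this
    exact this
  have hstay : ∀ k : ℝ → ℝ, (∀ θ ∈ Set.Icc (-Real.pi) Real.pi, HasDerivAt k (f θ (k θ)) θ) →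
      ∀ θ ∈ Set.Icc (-Real.pi) Real.pi, |k θ - k 0| ≤ C * Real.pi * ε₀ := fun k hk θ hθ => by
    have := abs_sub_initial_le hk (fun θ _ => hbd θ (k θ)) θ hθ
    rwa [hLpi] at this
  have htrue : ∀ k : ℝ → ℝ, |k 0 - z| ≤ η / 4 →
      (∀ θ ∈ Set.Icc (-Real.pi) Real.pi, HasDerivAt k (f θ (k θ)) θ) →
      ∀ θ ∈ Set.Icc (-Real.pi) Real.pi, |k θ - z| < η / 2 := fun k hk0 hk θ hθ => by
    have h1 := hstay k hk θ hθ
    have h2 := abs_sub_le (k θ) (k 0) z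
    linarith
  have hode : ∀ k : ℝ → ℝ, |k 0 - z| ≤ η / 4 →
      (∀ θ ∈ Set.Icc (-Real.pi) Real.pi, HasDerivAt k (f θ (k θ)) θ) →
      ∀ θ ∈ Set.Icc (-Real.pi) Real.pi, HasDerivAt k (R (θ, k θ, l, m)) θ :=
    fun k hk0 hk θ hθ => by
      have h1 := hk θ hθ
      simp only [hf] at h1
      rwa [hpreq _ (htrue k hk0 hk θ hθ)] at h1
  have hmpos := abs_pos.2 hm0
  have hsign : ∀ k₁ k₂ : ℝ → ℝ, k₁ 0 = z - c → k₂ 0 = z + c →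
      (∀ θ ∈ Set.Icc (-Real.pi) Real.pi, HasDerivAt k₁ (f θ (k₁ θ)) θ) →
      (∀ θ ∈ Set.Icc (-Real.pi) Real.pi, HasDerivAt k₂ (f θ (k₂ θ)) θ) →
      (k₁ Real.pi - k₁ (-Real.pi)) * (k₂ Real.pi - k₂ (-Real.pi)) ≤ 0 := by
    intro k₁ k₂ hk₁0 hk₂0 hk₁ hk₂
    have a1 : |k₁ 0 - z| ≤ η / 4 := by
      rw [hk₁0, abs_le]; constructor <;> linarith
    have a2 : |k₂ 0 - z| ≤ η / 4 := by
      rw [hk₂0, abs_le]; constructor <;> linarith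
    have b1 := hd₁ l m k₁ (by linarith) (by linarith) (hode k₁ a1 hk₁) (fun θ hθ => by
      have := hstay k₁ hk₁ θ hθ
      rw [hk₁0] at this
      linarith)
    have b2 := hd₂ l m k₂ (by linarith) (by linarith) (hode k₂ a2 hk₂) (fun θ hθ => by
      have := hstay k₂ hk₂ θ hθ
      rw [hk₂0] at this
      linarith)
    change |_ - 2 * m * M (z - c)| ≤ |M (z - c)| * |m| at b1
    change |_ - 2 * m * M (z + c)| ≤ |M (z + c)| * |m| at b2
    have key : ∀ d s : ℝ, |d - 2 * s| ≤ |s| → 0 ≤ d * s := by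
      intro d s hds
      rw [abs_le] at hds
      rcases le_total 0 s with h | h
      · rw [abs_of_nonneg h] at hds
        exact mul_nonneg (by linarith) h
      · rw [abs_of_nonpos h] at hds
        exact mul_nonneg_of_nonpos_of_nonpos (by linarith) h
    rw [mul_comm (|M (z - c)|), ← abs_mul, mul_assoc] at b1
    rw [mul_comm (|M (z + c)|), ← abs_mul, mul_assoc] at b2
    have c1 := key _ _ b1
    have c2 := key _ _ b2
    have c3 := mul_nonneg c1 c2
    have hm2 : 0 < m ^ 2 := by positivity
    by_contra hcon
    push Not at hcon
    have c4 : m ^ 2 * (M (z - c) * M (z + c)) < 0 := mul_neg_of_pos_of_neg hm2 hprod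
    nlinarith [mul_neg_of_pos_of_neg hcon c4]
  obtain ⟨h, hper, hsol, hh0⟩ := exists_periodic_solution (f := f) (L := L)
    (c₁ := z - c) (c₂ := z + c) hflip
    (fun x => hL2 (pr x) (hprmem x)) hbd (fun θ x => hR.periodic θ _) (by linarith) hsign
  have h0 : |h 0 - z| ≤ η / 4 := by
    rw [abs_le]
    constructor <;> linarith [hh0.1, hh0.2]
  have hclose : ∀ θ, |h θ - z| < η / 2 := fun θ => by
    obtain ⟨y, hy, hxy⟩ := hper.exists_mem_Ico Real.two_pi_pos θ (-Real.pi)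
    rw [hxy]
    exact htrue h h0 (fun θ _ => hsol θ) y ⟨hy.1, by linarith [hy.2]⟩
  refine ⟨h, hper, fun θ => ?_, fun θ => (hclose θ).trans (by linarith)⟩
  have h1 := hsol θ
  simp only [hf] at h1
  rwa [hpreq _ (hclose θ)] at h1

end ReversibleField

/-- The Hamiltonian in polar coordinates `x = r sin θ`, `y = r cos θ`. -/
noncomputable def polarHam (G : ℝ → ℝ) (θ r : ℝ) : ℝ :=
  (r * Real.cos θ) ^ 2 / 2 + G (r * Real.sin θ)

/-- `y ^ 2 + x g(x)` in polar coordinates. -/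
noncomputable def polarDen (g : ℝ → ℝ) (θ r : ℝ) : ℝ :=
  (r * Real.cos θ) ^ 2 + r * Real.sin θ * g (r * Real.sin θ)

/-- `y ^ 2 / 2 + G(x)` is strictly increasing along rays outside the disc of radius `R₀`, is at
most `H₀` on that disc, and `g` is the derivative of the even potential `G`. -/
structure RadialPotential (G g : ℝ → ℝ) (R₀ H₀ : ℝ) : Prop where
  pos : 0 < R₀
  hasDerivAt : ∀ x, HasDerivAt G (g x) x
  contDiff : ContDiff ℝ 2 g
  even : ∀ x, G (-x) = G x
  den_pos : ∀ θ r, R₀ ≤ r → 0 < polarDen g θ r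
  le : ∀ θ r, 0 ≤ r → r ≤ R₀ → polarHam G θ r ≤ H₀
  tendsto : ∀ θ, Tendsto (polarHam G θ) atTop atTop

/-- The radius at angle `θ` of the level curve of height `h`. -/
noncomputable def levelRadius (G : ℝ → ℝ) (R₀ θ h : ℝ) : ℝ :=
  Classical.epsilon fun r => R₀ < r ∧ polarHam G θ r = h

theorem isInvertible_of_apply_one_ne_zero {L : ℝ →L[ℝ] ℝ} (h : L 1 ≠ 0) : L.IsInvertible := by
  refine ⟨ContinuousLinearEquiv.unitsEquivAut ℝ (Units.mk0 (L 1) h), ?_⟩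
  ext
  simp

theorem odd_of_hasDerivAt_even {G g : ℝ → ℝ} (hd : ∀ x, HasDerivAt G (g x) x)
    (he : ∀ x, G (-x) = G x) (x : ℝ) : g (-x) = -g x := by
  have h1 : HasDerivAt (fun x => G (-x)) (-g (-x)) x := by
    exact ((hd (-x)).comp x (hasDerivAt_neg x)).congr_deriv (by simp)
  have h2 : (fun x => G (-x)) = G := funext he
  rw [h2] at h1
  have := h1.unique (hd x)
  linarith

namespace RadialPotential

variable {G g : ℝ → ℝ} {R₀ H₀ : ℝ}

theorem contDiff_potential (hG : RadialPotential G g R₀ H₀) : ContDiff ℝ 2 G := by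
  have h1 : ContDiff ℝ (1 + 1) G := by
    rw [contDiff_succ_iff_deriv]
    refine ⟨fun x => (hG.hasDerivAt x).differentiableAt, by simp, ?_⟩
    have : deriv G = g := funext fun x => (hG.hasDerivAt x).deriv
    rw [this]
    exact hG.contDiff.of_le (by norm_num)
  exact h1.of_le (by norm_num)

theorem odd (hG : RadialPotential G g R₀ H₀) (x : ℝ) : g (-x) = -g x :=
  odd_of_hasDerivAt_even hG.hasDerivAt hG.even x

theorem hasDerivAt_polarHam (hG : RadialPotential G g R₀ H₀) {θ r : ℝ} (hr : r ≠ 0) :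
    HasDerivAt (polarHam G θ) (polarDen g θ r / r) r := by
  unfold polarHam polarDen
  have h1 : HasDerivAt (fun r => r * Real.cos θ) (Real.cos θ) r := by
    simpa using (hasDerivAt_id r).mul_const (Real.cos θ)
  have h2 : HasDerivAt (fun r => r * Real.sin θ) (Real.sin θ) r := by
    simpa using (hasDerivAt_id r).mul_const (Real.sin θ)
  refine (((h1.pow 2).div_const 2).add ((hG.hasDerivAt _).comp r h2)).congr_deriv ?_
  field_simp
  norm_num
  ring

theorem strictMonoOn_polarHam (hG : RadialPotential G g R₀ H₀) (θ : ℝ) :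
    StrictMonoOn (polarHam G θ) (Set.Ici R₀) := by
  have hne : ∀ r ∈ Set.Ici R₀, 0 < r := fun r hr => hG.pos.trans_le hr
  refine strictMonoOn_of_deriv_pos (convex_Ici R₀)
    (fun r hr => (hG.hasDerivAt_polarHam (hne r hr).ne').continuousAt.continuousWithinAt) ?_
  intro r hr
  rw [interior_Ici] at hr
  have hr' : r ∈ Set.Ici R₀ := Set.Ioi_subset_Ici_self hr
  rw [(hG.hasDerivAt_polarHam (hne r hr').ne').deriv]
  exact div_pos (hG.den_pos θ r hr') (hne r hr')

theorem exists_radius (hG : RadialPotential G g R₀ H₀) {θ h : ℝ} (hh : H₀ < h) :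
    ∃ r, R₀ < r ∧ polarHam G θ r = h := by
  obtain ⟨r, hr, hrR⟩ := (((hG.tendsto θ).eventually_ge_atTop h).and
    (eventually_ge_atTop R₀)).exists
  have hle := hG.le θ R₀ hG.pos.le le_rfl
  have hc : ContinuousOn (polarHam G θ) (Set.Icc R₀ r) := fun s hs =>
    (hG.hasDerivAt_polarHam (hG.pos.trans_le hs.1).ne').continuousAt.continuousWithinAt
  obtain ⟨s, hs, hsh⟩ := intermediate_value_Icc hrR hc ⟨by linarith, hr⟩
  refine ⟨s, lt_of_le_of_ne hs.1 ?_, hsh⟩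
  rintro rfl
  linarith

theorem lt_levelRadius (hG : RadialPotential G g R₀ H₀) {θ h : ℝ} (hh : H₀ < h) :
    R₀ < levelRadius G R₀ θ h :=
  (Classical.epsilon_spec (hG.exists_radius (θ := θ) hh)).1

theorem polarHam_levelRadius (hG : RadialPotential G g R₀ H₀) {θ h : ℝ} (hh : H₀ < h) :
    polarHam G θ (levelRadius G R₀ θ h) = h :=
  (Classical.epsilon_spec (hG.exists_radius (θ := θ) hh)).2

theorem levelRadius_eq (hG : RadialPotential G g R₀ H₀) {θ r : ℝ} (hr : R₀ < r)
    (hh : H₀ < polarHam G θ r) : levelRadius G R₀ θ (polarHam G θ r) = r :=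
  (hG.strictMonoOn_polarHam θ).injOn (hG.lt_levelRadius hh).le hr.le (hG.polarHam_levelRadius hh)

theorem levelRadius_periodic (G : ℝ → ℝ) (R₀ θ h : ℝ) :
    levelRadius G R₀ (θ + 2 * Real.pi) h = levelRadius G R₀ θ h := by
  simp [levelRadius, polarHam]

theorem levelRadius_neg (hG : RadialPotential G g R₀ H₀) (θ h : ℝ) :
    levelRadius G R₀ (-θ) h = levelRadius G R₀ θ h := by
  simp [levelRadius, polarHam, hG.even]

theorem contDiffAt_levelRadius (hG : RadialPotential G g R₀ H₀) {θ h : ℝ} (hh : H₀ < h) :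
    ContDiffAt ℝ 2 (fun p : ℝ × ℝ => levelRadius G R₀ p.1 p.2) (θ, h) := by
  set r₀ := levelRadius G R₀ θ h with hr₀
  have hr₀R : R₀ < r₀ := hG.lt_levelRadius hh
  have hr₀0 : r₀ ≠ 0 := (hG.pos.trans hr₀R).ne'
  have hGc := hG.contDiff_potential
  have hf : ContDiff ℝ 2 (fun u : (ℝ × ℝ) × ℝ => polarHam G u.1.1 u.2 - u.1.2) := by
    unfold polarHam
    have hc : ContDiff ℝ 2 Real.cos := Real.contDiff_cos
    have hs : ContDiff ℝ 2 Real.sin := Real.contDiff_sin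
    fun_prop
  have hfa : ContDiffAt ℝ 2 (fun u : (ℝ × ℝ) × ℝ => polarHam G u.1.1 u.2 - u.1.2) ((θ, h), r₀) :=
    hf.contDiffAt
  have hinv : (fderiv ℝ (fun u : (ℝ × ℝ) × ℝ => polarHam G u.1.1 u.2 - u.1.2) ((θ, h), r₀) ∘L
      .inr ℝ (ℝ × ℝ) ℝ).IsInvertible := by
    refine isInvertible_of_apply_one_ne_zero ?_
    have h1 : HasDerivAt (fun r => polarHam G θ r - h)
        (fderiv ℝ (fun u : (ℝ × ℝ) × ℝ => polarHam G u.1.1 u.2 - u.1.2) ((θ, h), r₀)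
          ((0 : ℝ × ℝ), (1 : ℝ))) r₀ := by
      have hcurve : HasDerivAt (fun r : ℝ => ((θ, h), r)) ((0 : ℝ × ℝ), (1 : ℝ)) r₀ :=
        (hasDerivAt_const r₀ (θ, h)).prodMk (hasDerivAt_id r₀)
      exact (hfa.differentiableAt (by simp)).hasFDerivAt.comp_hasDerivAt r₀ hcurve
    have h2 := h1.unique ((hG.hasDerivAt_polarHam (θ := θ) hr₀0).sub_const h)
    change fderiv ℝ (fun u : (ℝ × ℝ) × ℝ => polarHam G u.1.1 u.2 - u.1.2) ((θ, h), r₀)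
          ((0 : ℝ × ℝ), (1 : ℝ)) ≠ 0
    rw [h2]
    exact div_ne_zero (hG.den_pos θ r₀ hr₀R.le).ne' hr₀0
  have hψ := hfa.contDiffAt_implicitFunction (by simp) hinv
  refine hψ.congr_of_eventuallyEq ?_
  have e0 : hfa.implicitFunction (by simp) hinv (θ, h) = r₀ :=
    hfa.implicitFunction_apply_self (by simp) hinv
  have e1 := hfa.eventually_apply_implicitFunction (by simp) hinv
  have e2 : ∀ᶠ p in 𝓝 (θ, h), R₀ < hfa.implicitFunction (by simp) hinv p := by
    have := hψ.continuousAt.tendsto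
    simp only at this
    rw [e0] at this
    exact this.eventually_const_lt hr₀R
  have e3 : ∀ᶠ p : ℝ × ℝ in 𝓝 (θ, h), H₀ < p.2 :=
    (continuous_snd.tendsto (θ, h)).eventually_const_lt hh
  filter_upwards [e1, e2, e3] with p h1 h2 h3
  have h4 : polarHam G p.1 (hfa.implicitFunction (by simp) hinv p) = p.2 := by
    have hz : polarHam G θ r₀ - h = 0 := sub_eq_zero.2 (hG.polarHam_levelRadius hh)
    simp only [hz] at h1
    linarith
  have h5 := hG.levelRadius_eq h2 (by rw [h4]; exact h3)
  rw [h4] at h5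
  exact h5

end RadialPotential

/-- The derivative of the height `h` with respect to the angle `θ` along solutions of
`x' = y - (l F₂(x) + m F₁(x))`, `y' = -g(x)`. -/
noncomputable def polarRhs (G g F₂ F₁ : ℝ → ℝ) (R₀ : ℝ) (q : ℝ × ℝ × ℝ × ℝ) : ℝ :=
  let r := levelRadius G R₀ q.1 q.2.1
  let x := r * Real.sin q.1
  let F := q.2.2.1 * F₂ x + q.2.2.2 * F₁ x
  F * -g x * r ^ 2 / (polarDen g q.1 r - r * Real.cos q.1 * F)

namespace RadialPotential

variable {G g F₂ F₁ : ℝ → ℝ} {R₀ H₀ : ℝ}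

theorem polarDen_neg (hG : RadialPotential G g R₀ H₀) (θ r : ℝ) :
    polarDen g (-θ) r = polarDen g θ r := by
  simp [polarDen, hG.odd]

theorem reversibleField (hG : RadialPotential G g R₀ H₀) (hF₂ : ContDiff ℝ 2 F₂)
    (hF₁ : ContDiff ℝ 2 F₁) (hF₂e : ∀ x, F₂ (-x) = F₂ x) (hF₁o : ∀ x, F₁ (-x) = -F₁ x)
    {z : ℝ} (hz : H₀ < z) : ReversibleField (polarRhs G g F₂ F₁ R₀) z where
  contDiffAt θ := by
    have hr : ContDiffAt ℝ 2 (fun q : ℝ × ℝ × ℝ × ℝ => levelRadius G R₀ q.1 q.2.1) (θ, z, 0, 0) :=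
      ContDiffAt.comp (g := fun p : ℝ × ℝ => levelRadius G R₀ p.1 p.2)
        (f := fun q : ℝ × ℝ × ℝ × ℝ => (q.1, q.2.1)) (θ, z, 0, 0)
        (hG.contDiffAt_levelRadius hz) (by fun_prop)
    have hg := hG.contDiff
    have hc : ContDiff ℝ 2 Real.cos := Real.contDiff_cos
    have hs : ContDiff ℝ 2 Real.sin := Real.contDiff_sin
    unfold polarRhs polarDen
    refine ContDiffAt.div (by fun_prop) (by fun_prop) ?_
    have := (hG.den_pos θ _ (hG.lt_levelRadius (θ := θ) hz).le).ne'
    simpa [polarDen] using this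
  periodic θ q := by
    simp [polarRhs, levelRadius_periodic, polarDen]
  odd θ h l m := by
    simp only [polarRhs, hG.levelRadius_neg, hG.polarDen_neg, Real.sin_neg, Real.cos_neg, mul_neg,
      hF₂e, hF₁o, hG.odd, neg_mul, neg_neg]
    rw [← neg_div]
    congr 1
    ring
  zero θ h := by
    simp [polarRhs]

theorem mCoeff_polarRhs (hG : RadialPotential G g R₀ H₀) (hF₂ : ContDiff ℝ 2 F₂)
    (hF₁ : ContDiff ℝ 2 F₁) (hF₂e : ∀ x, F₂ (-x) = F₂ x) (hF₁o : ∀ x, F₁ (-x) = -F₁ x)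
    {θ h : ℝ} (hh : H₀ < h) :
    mCoeff (polarRhs G g F₂ F₁ R₀) θ h =
      -(F₁ (levelRadius G R₀ θ h * Real.sin θ) * g (levelRadius G R₀ θ h * Real.sin θ)
        * levelRadius G R₀ θ h ^ 2 / polarDen g θ (levelRadius G R₀ θ h)) := by
  have hR := hG.reversibleField hF₂ hF₁ hF₂e hF₁o hh
  have hcurve : HasDerivAt (fun m : ℝ => (θ, h, (0 : ℝ), m)) ((0 : ℝ), (0 : ℝ), (0 : ℝ), (1 : ℝ))
      0 :=
    (hasDerivAt_const 0 θ).prodMk ((hasDerivAt_const 0 h).prodMk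
      ((hasDerivAt_const 0 0).prodMk (hasDerivAt_id 0)))
  have h1 := ((hR.contDiffAt θ).differentiableAt (by simp)).hasFDerivAt.comp_hasDerivAt
    (0 : ℝ) hcurve
  have hD := (hG.den_pos θ _ (hG.lt_levelRadius (θ := θ) hh).le).ne'
  set r := levelRadius G R₀ θ h with hr
  have hnum : HasDerivAt (fun m : ℝ => m * F₁ (r * Real.sin θ) * -g (r * Real.sin θ) * r ^ 2)
      (-(F₁ (r * Real.sin θ) * g (r * Real.sin θ) * r ^ 2)) 0 := by
    have := ((hasDerivAt_id (0 : ℝ)).mul_const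
      (-(F₁ (r * Real.sin θ) * g (r * Real.sin θ) * r ^ 2)))
    refine (this.congr_of_eventuallyEq (.of_forall fun m => ?_)).congr_deriv (by simp)
    simp only [id]
    ring
  have hden : HasDerivAt (fun m : ℝ => polarDen g θ r - r * Real.cos θ * (m * F₁ (r * Real.sin θ)))
      (-(r * Real.cos θ * F₁ (r * Real.sin θ))) 0 := by
    have := ((hasDerivAt_id (0 : ℝ)).mul_const (r * Real.cos θ * F₁ (r * Real.sin θ))).const_sub
      (polarDen g θ r)
    refine (this.congr_of_eventuallyEq (.of_forall fun m => ?_)).congr_deriv (by simp)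
    simp only [id]
    ring
  have h2 := hnum.div hden (by simpa using hD)
  have h3 : (polarRhs G g F₂ F₁ R₀ ∘ fun m : ℝ => (θ, h, (0 : ℝ), m)) =
      (fun m : ℝ => m * F₁ (r * Real.sin θ) * -g (r * Real.sin θ) * r ^ 2) /
        fun m : ℝ => polarDen g θ r - r * Real.cos θ * (m * F₁ (r * Real.sin θ)) := by
    funext m
    simp [polarRhs, ← hr]
  rw [h3] at h1
  have h4 := h1.unique h2
  unfold mCoeff
  rw [h4]
  simp only [mul_zero, zero_mul, sub_zero]
  field_simp

end RadialPotential

/-- `x g(x)` is bounded below and grows at least quadratically. -/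
structure CoerciveForce (g : ℝ → ℝ) (c X₀ C : ℝ) : Prop where
  c_pos : 0 < c
  c_le : c ≤ 1
  X₀_pos : 0 < X₀
  C_nonneg : 0 ≤ C
  quadratic : ∀ x, X₀ ≤ |x| → c * x ^ 2 ≤ x * g x
  lower : ∀ x, -C ≤ x * g x

theorem exists_coerciveForce {P : ℝ[X]} (heven : ∀ x : ℝ, P.eval (-x) = P.eval x)
    (hdeg : 2 ≤ P.natDegree) (hinf : Tendsto (fun x : ℝ => P.eval x) (cocompact ℝ) atTop) :
    ∃ c X₀ C, CoerciveForce (fun x => P.derivative.eval x) c X₀ C := by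
  have htop : Tendsto (fun x : ℝ => P.eval x) atTop atTop := hinf.mono_left atTop_le_cocompact
  have hlead := (Polynomial.tendsto_atTop_iff_leadingCoeff_nonneg P).1 htop
  have hP0 : P ≠ 0 := by
    rintro rfl
    simp at hdeg
  have hdnat : P.derivative.natDegree = P.natDegree - 1 := Polynomial.natDegree_derivative P
  have hd0 : P.derivative ≠ 0 := by
    intro h
    rw [h] at hdnat
    simp at hdnat
    omega
  have hQ0 : (X * P.derivative : ℝ[X]) ≠ 0 := mul_ne_zero X_ne_zero hd0
  have hQnat : (X * P.derivative : ℝ[X]).natDegree = P.natDegree := by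
    rw [natDegree_mul X_ne_zero hd0, natDegree_X, hdnat]
    omega
  have hQlead : 0 ≤ (X * P.derivative : ℝ[X]).leadingCoeff := by
    rw [leadingCoeff_mul, leadingCoeff_X, one_mul, leadingCoeff, hdnat, coeff_derivative]
    have : P.natDegree - 1 + 1 = P.natDegree := by omega
    rw [this]
    exact mul_nonneg hlead.2 (by positivity)
  have hQtop : Tendsto (fun x : ℝ => (X * P.derivative : ℝ[X]).eval x) atTop atTop := by
    rw [Polynomial.tendsto_atTop_iff_leadingCoeff_nonneg]
    refine ⟨?_, hQlead⟩
    rw [← natDegree_pos_iff_degree_pos, hQnat]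
    omega
  have hO : (fun x : ℝ => (X ^ 2 : ℝ[X]).eval x) =O[atTop]
      fun x : ℝ => (X * P.derivative : ℝ[X]).eval x := by
    refine Polynomial.isBigO_atTop_of_degree_le _ _ ?_
    rw [degree_X_pow, degree_eq_natDegree hQ0, hQnat]
    exact_mod_cast hdeg
  obtain ⟨K, hK, hb⟩ := hO.exists_pos
  obtain ⟨X₁, hX₁⟩ := eventually_atTop.1 (hb.bound.and (hQtop.eventually_gt_atTop 0))
  have hodd := odd_of_hasDerivAt_even (fun x => P.hasDerivAt x) heven
  have hsym : ∀ x : ℝ, x * P.derivative.eval x = |x| * P.derivative.eval |x| := by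
    intro x
    rcases abs_choice x with h | h <;> rw [h]
    rw [hodd]
    ring
  obtain ⟨B, hB⟩ := (isCompact_Icc (a := -max X₁ 1) (b := max X₁ 1)).bddBelow_image
    (f := fun x : ℝ => x * P.derivative.eval x) (by fun_prop)
  have hquad : ∀ x : ℝ, max X₁ 1 ≤ |x| → min (1 / K) 1 * x ^ 2 ≤ x * P.derivative.eval x := by
    intro x hx
    obtain ⟨h1, h2⟩ := hX₁ |x| ((le_max_left _ _).trans hx)
    simp only [eval_mul, eval_X, eval_pow, Real.norm_eq_abs] at h1 h2
    rw [abs_of_pos h2, ← hsym, abs_pow, abs_abs, sq_abs] at h1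
    calc min (1 / K) 1 * x ^ 2 ≤ 1 / K * x ^ 2 := by gcongr; exact min_le_left _ _
      _ ≤ x * P.derivative.eval x := by
        rw [one_div, inv_mul_le_iff₀ hK]
        exact h1
  refine ⟨min (1 / K) 1, max X₁ 1, max 0 (-B), by positivity, min_le_right _ _, by positivity,
    le_max_left _ _, hquad, ?_⟩
  intro x
  rcases le_total |x| (max X₁ 1) with h | h
  · have := hB (Set.mem_image_of_mem _ (abs_le.1 h))
    have h2 := le_max_right 0 (-B)
    linarith
  · have h2 := hquad x h
    have : 0 ≤ min (1 / K) 1 * x ^ 2 := by positivity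
    have h3 := le_max_left 0 (-B)
    linarith

theorem CoerciveForce.exists_radialPotential {G g : ℝ → ℝ} {c X₀ C : ℝ}
    (hg : CoerciveForce g c X₀ C) (hd : ∀ x, HasDerivAt G (g x) x) (hgc : ContDiff ℝ 2 g)
    (he : ∀ x, G (-x) = G x) (hinf : Tendsto G (cocompact ℝ) atTop) :
    ∃ R₀ H₀, RadialPotential G g R₀ H₀ := by
  have hX := hg.X₀_pos
  have hC := hg.C_nonneg
  have hc := hg.c_pos
  have hGc : Continuous G := continuous_iff_continuousAt.2 fun x => (hd x).continuousAt
  set R₀ := X₀ + C + 1 with hR₀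
  obtain ⟨B, hB⟩ := (isCompact_Icc (a := -R₀) (b := R₀)).bddAbove_image (f := G) hGc.continuousOn
  refine ⟨R₀, R₀ ^ 2 / 2 + B, by positivity, hd, hgc, he, ?_, ?_, ?_⟩
  · intro θ r hr
    unfold polarDen
    have hcs := Real.sin_sq_add_cos_sq θ
    have hr2 : R₀ ^ 2 ≤ r ^ 2 := by gcongr
    have hsum : (r * Real.cos θ) ^ 2 + (r * Real.sin θ) ^ 2 = r ^ 2 := by
      linear_combination r ^ 2 * hcs
    rcases le_total X₀ |r * Real.sin θ| with h | h
    · have h1 := hg.quadratic _ h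
      have h2 : 0 < (r * Real.sin θ) ^ 2 := by
        rw [← sq_abs]
        have := hX.trans_le h
        positivity
      have := mul_pos hc h2
      nlinarith [sq_nonneg (r * Real.cos θ)]
    · have h1 := hg.lower (r * Real.sin θ)
      have h2 : (r * Real.sin θ) ^ 2 ≤ X₀ ^ 2 := by
        rw [← sq_abs (r * Real.sin θ)]
        gcongr
      nlinarith
  · intro θ r h0 hr
    unfold polarHam
    have h1 : |r * Real.sin θ| ≤ R₀ := by
      rw [abs_mul, abs_of_nonneg h0]
      nlinarith [Real.abs_sin_le_one θ, abs_nonneg (Real.sin θ)]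
    have h2 : (r * Real.cos θ) ^ 2 ≤ R₀ ^ 2 := by
      rw [mul_pow]
      have : r ^ 2 ≤ R₀ ^ 2 := by gcongr
      nlinarith [Real.cos_sq_le_one θ, sq_nonneg r, sq_nonneg (Real.cos θ)]
    have h3 := hB (Set.mem_image_of_mem G (abs_le.1 h1))
    linarith
  · intro θ
    by_cases hs : Real.sin θ = 0
    · have hcos : Real.cos θ ^ 2 = 1 := by
        have := Real.sin_sq_add_cos_sq θ
        rw [hs] at this
        linarith
      have : polarHam G θ = fun r => r ^ 2 / 2 + G 0 := by
        funext r
        simp [polarHam, hs, mul_pow, hcos]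
      rw [this]
      exact tendsto_atTop_add_const_right _ _
        ((tendsto_pow_atTop (by norm_num)).atTop_div_const (by norm_num))
    · have h1 : Tendsto (fun r => r * Real.sin θ) atTop (cocompact ℝ) :=
        ((Homeomorph.mulRight₀ _ hs).isClosedEmbedding.tendsto_cocompact).mono_left
          atTop_le_cocompact
      refine tendsto_atTop_mono (fun r => ?_) (hinf.comp h1)
      simp only [polarHam, Function.comp]
      nlinarith [sq_nonneg (r * Real.cos θ)]

theorem exists_pos_le_of_periodic {f : ℝ → ℝ} {T : ℝ} (hT : 0 < T) (hf : Continuous f)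
    (hper : Function.Periodic f T) (hpos : ∀ x, 0 < f x) : ∃ c, 0 < c ∧ ∀ x, c ≤ f x := by
  obtain ⟨x₀, -, hx₀⟩ := (isCompact_Icc (a := (0 : ℝ)) (b := T)).exists_isMinOn
    ⟨0, by simp [hT.le]⟩ hf.continuousOn
  refine ⟨f x₀, hpos x₀, fun x => ?_⟩
  obtain ⟨y, hy, hxy⟩ := hper.exists_mem_Ico₀ hT x
  rw [hxy]
  exact hx₀ (Set.Ico_subset_Icc_self hy)

theorem exists_inverse_of_deriv_ge {f f' : ℝ → ℝ} {c : ℝ} (hc : 0 < c)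
    (hf : ∀ x, HasDerivAt f (f' x) x) (hle : ∀ x, c ≤ f' x) :
    ∃ φ : ℝ → ℝ, (∀ x, φ (f x) = x) ∧ (∀ t, f (φ t) = t) ∧
      ∀ t, HasDerivAt φ (f' (φ t))⁻¹ t := by
  have hmono : StrictMono f := strictMono_of_hasDerivAt_pos hf fun x => hc.trans_le (hle x)
  have hcont : Continuous f := continuous_iff_continuousAt.2 fun x => (hf x).continuousAt
  have hm : Monotone fun x => f x - c * x := by
    refine monotone_of_hasDerivAt_nonneg (f' := fun x => f' x - c) (fun x => ?_)
      fun x => sub_nonneg.2 (hle x)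
    exact ((hf x).sub ((hasDerivAt_id x).const_mul c)).congr_deriv (by simp)
  have htop : Tendsto f atTop atTop := by
    refine tendsto_atTop_mono' _ ?_ (tendsto_atTop_add_const_right _ (f 0)
      (tendsto_id.const_mul_atTop hc))
    filter_upwards [eventually_ge_atTop 0] with x hx
    have := hm hx
    simp only [mul_zero, sub_zero, id] at this ⊢
    linarith
  have hbot : Tendsto f atBot atBot := by
    refine tendsto_atBot_mono' _ ?_ (tendsto_atBot_add_const_right _ (f 0)
      (tendsto_id.const_mul_atBot hc))
    filter_upwards [eventually_le_atBot 0] with x hx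
    have := hm hx
    simp only [mul_zero, sub_zero, id] at this ⊢
    linarith
  let e := hmono.orderIsoOfSurjective f (hcont.surjective htop hbot)
  have he : ∀ x, e x = f x := fun x => rfl
  refine ⟨e.symm, fun x => ?_, fun t => ?_, fun t => ?_⟩
  · rw [← he]
    simp
  · rw [← he]
    simp
  · have hfe : ∀ t, f (e.symm t) = t := fun t => by
      rw [← he]
      simp
    exact (hf (e.symm t)).of_local_left_inverse (e.symm.continuous.continuousAt)
      (hc.trans_le (hle _)).ne' (.of_forall hfe)

theorem exists_polar (p : ℝ × ℝ) :
    ∃ θ r : ℝ, 0 ≤ r ∧ p = (r * Real.sin θ, r * Real.cos θ) := by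
  let w : ℂ := ⟨p.2, p.1⟩
  refine ⟨w.arg, ‖w‖, norm_nonneg _, ?_⟩
  have h1 := Complex.norm_mul_cos_arg w
  have h2 := Complex.norm_mul_sin_arg w
  rw [h1, h2]

/-- The planar field `x' = y - (l F₂(x) + m F₁(x))`, `y' = -g(x)`. -/
def planarField (g F₂ F₁ : ℝ → ℝ) (l m : ℝ) (p : ℝ × ℝ) : ℝ × ℝ :=
  (p.2 - (l * F₂ p.1 + m * F₁ p.1), -g p.1)

/-- The angular velocity, multiplied by `r ^ 2`, of `planarField` at the point of height `h` and
angle `θ`. -/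
noncomputable def polarSpeed (G g F₂ F₁ : ℝ → ℝ) (R₀ : ℝ) (q : ℝ × ℝ × ℝ × ℝ) : ℝ :=
  let r := levelRadius G R₀ q.1 q.2.1
  polarDen g q.1 r - r * Real.cos q.1 *
    (q.2.2.1 * F₂ (r * Real.sin q.1) + q.2.2.2 * F₁ (r * Real.sin q.1))

/-- The point of height `h` and angle `θ`. -/
noncomputable def levelPoint (G : ℝ → ℝ) (R₀ θ h : ℝ) : ℝ × ℝ :=
  (levelRadius G R₀ θ h * Real.sin θ, levelRadius G R₀ θ h * Real.cos θ)

namespace RadialPotential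

variable {G g F₂ F₁ : ℝ → ℝ} {R₀ H₀ : ℝ}

theorem eventually_polarSpeed_pos (hG : RadialPotential G g R₀ H₀) (hF₂ : Continuous F₂)
    (hF₁ : Continuous F₁) {z : ℝ} (hz : H₀ < z) :
    ∀ᶠ q : ℝ × ℝ × ℝ in 𝓝 (z, 0, 0), ∀ θ, 0 < polarSpeed G g F₂ F₁ R₀ (θ, q) := by
  refine eventually_forall_of_periodic Real.two_pi_pos (fun θ q => ?_) fun θ => ?_
  · simp [polarSpeed, levelRadius_periodic, polarDen]
  · have hr : ContinuousAt (fun q : ℝ × ℝ × ℝ × ℝ => levelRadius G R₀ q.1 q.2.1) (θ, z, 0, 0) :=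
      ContinuousAt.comp (g := fun p : ℝ × ℝ => levelRadius G R₀ p.1 p.2)
        (f := fun q : ℝ × ℝ × ℝ × ℝ => (q.1, q.2.1)) (x := (θ, z, 0, 0))
        (hG.contDiffAt_levelRadius hz).continuousAt (by fun_prop)
    have hg := hG.contDiff.continuous
    have hc : ContinuousAt (polarSpeed G g F₂ F₁ R₀) (θ, z, 0, 0) := by
      unfold polarSpeed polarDen
      fun_prop
    refine hc.eventually_const_lt ?_
    simpa [polarSpeed] using hG.den_pos θ _ (hG.lt_levelRadius (θ := θ) hz).le

end RadialPotential

namespace RadialPotential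

variable {G g F₂ F₁ : ℝ → ℝ} {R₀ H₀ l m : ℝ} {h : ℝ → ℝ}

theorem hasDerivAt_levelPoint (hG : RadialPotential G g R₀ H₀)
    (hh : ∀ θ, HasDerivAt h (polarRhs G g F₂ F₁ R₀ (θ, h θ, l, m)) θ) (hH : ∀ θ, H₀ < h θ)
    (hpos : ∀ θ, 0 < polarSpeed G g F₂ F₁ R₀ (θ, h θ, l, m)) (θ : ℝ) :
    HasDerivAt (fun θ => levelPoint G R₀ θ (h θ))
      ((levelRadius G R₀ θ (h θ) ^ 2 / polarSpeed G g F₂ F₁ R₀ (θ, h θ, l, m)) •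
        planarField g F₂ F₁ l m (levelPoint G R₀ θ (h θ))) θ := by
  have hρd : DifferentiableAt ℝ (fun θ => levelRadius G R₀ θ (h θ)) θ :=
    DifferentiableAt.comp (g := fun p : ℝ × ℝ => levelRadius G R₀ p.1 p.2)
      (f := fun θ => (θ, h θ)) θ ((hG.contDiffAt_levelRadius (hH θ)).differentiableAt (by simp))
      (differentiableAt_id.prodMk (hh θ).differentiableAt)
  obtain ⟨ρ', hρ'⟩ : ∃ ρ', HasDerivAt (fun θ => levelRadius G R₀ θ (h θ)) ρ' θ :=
    ⟨_, hρd.hasDerivAt⟩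
  have hx := hρ'.mul (Real.hasDerivAt_sin θ)
  have hy := hρ'.mul (Real.hasDerivAt_cos θ)
  have hHam := HasDerivAt.congr_of_eventuallyEq (f₁ := h)
    (((hy.pow 2).div_const 2).add ((hG.hasDerivAt _).comp θ hx))
    (.of_forall fun s => (hG.polarHam_levelRadius (θ := s) (hH s)).symm)
  have heq := hHam.unique (hh θ)
  have hS := (hpos θ).ne'
  have hD := (hG.den_pos θ _ (hG.lt_levelRadius (θ := θ) (hH θ)).le).ne'
  refine (hx.prodMk hy).congr_deriv ?_
  have hcs := Real.sin_sq_add_cos_sq θ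
  simp only [polarSpeed, polarRhs, Pi.mul_apply, polarDen] at heq hS hD
  simp only [planarField, levelPoint, polarSpeed, polarDen, Prod.smul_mk, smul_eq_mul]
  generalize hρ : levelRadius G R₀ θ (h θ) = ρ at *
  generalize hxx : Real.sin θ = s at *
  generalize hcc : Real.cos θ = c at *
  generalize hgg : g (ρ * s) = γ at *
  generalize hFF : l * F₂ (ρ * s) + m * F₁ (ρ * s) = F at *
  generalize hSS : (ρ * c) ^ 2 + ρ * s * γ - ρ * c * F = S at *
  have hSF : S = ρ * c * (ρ * c - F) + ρ * s * γ := by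
    rw [← hSS]
    ring
  have e1 : ρ * c * (ρ ^ 2 / S * (ρ * c - F)) - ρ * s * (ρ ^ 2 / S * -γ) = ρ ^ 2 := by
    field_simp
    rw [hSF]
    ring
  have e2 : γ * (ρ ^ 2 / S * (ρ * c - F)) + ρ * c * (ρ ^ 2 / S * -γ) = F * -γ * ρ ^ 2 / S := by
    field_simp
    ring
  have e3 : ρ * c * (ρ' * s + ρ * c) - ρ * s * (ρ' * c + ρ * -s) = ρ ^ 2 := by
    linear_combination ρ ^ 2 * hcs
  have e4 : γ * (ρ' * s + ρ * c) + ρ * c * (ρ' * c + ρ * -s) = F * -γ * ρ ^ 2 / S := by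
    rw [← heq]
    norm_num
    ring
  ext
  · apply mul_left_cancel₀ hD
    simp only
    linear_combination ρ * c * (e3 - e1) + ρ * s * (e4 - e2)
  · apply mul_left_cancel₀ hD
    simp only
    linear_combination ρ * c * (e4 - e2) - γ * (e3 - e1)

theorem isPeriodicOrbit_levelPoint (hG : RadialPotential G g R₀ H₀) (hF₂ : Continuous F₂)
    (hF₁ : Continuous F₁)
    (hh : ∀ θ, HasDerivAt h (polarRhs G g F₂ F₁ R₀ (θ, h θ, l, m)) θ) (hH : ∀ θ, H₀ < h θ)
    (hpos : ∀ θ, 0 < polarSpeed G g F₂ F₁ R₀ (θ, h θ, l, m))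
    (hper : Function.Periodic h (2 * Real.pi)) :
    IsPeriodicOrbit (planarField g F₂ F₁ l m) (Set.range fun θ => levelPoint G R₀ θ (h θ)) := by
  have hρpos : ∀ θ, 0 < levelRadius G R₀ θ (h θ) := fun θ =>
    hG.pos.trans (hG.lt_levelRadius (hH θ))
  have hhc : Continuous h := continuous_iff_continuousAt.2 fun θ => (hh θ).continuousAt
  have hρc : Continuous fun θ => levelRadius G R₀ θ (h θ) := by
    refine continuous_iff_continuousAt.2 fun θ => ?_
    exact ContinuousAt.comp (g := fun p : ℝ × ℝ => levelRadius G R₀ p.1 p.2)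
      (f := fun θ => (θ, h θ)) (hG.contDiffAt_levelRadius (hH θ)).continuousAt
      (by fun_prop)
  have hgc := hG.contDiff.continuous
  set f' : ℝ → ℝ := fun θ =>
    levelRadius G R₀ θ (h θ) ^ 2 / polarSpeed G g F₂ F₁ R₀ (θ, h θ, l, m) with hf'
  have hSc : Continuous fun θ => polarSpeed G g F₂ F₁ R₀ (θ, h θ, l, m) := by
    unfold polarSpeed polarDen
    fun_prop
  have hf'c : Continuous f' := (hρc.pow 2).div hSc fun θ => (hpos θ).ne'
  have hf'p : Function.Periodic f' (2 * Real.pi) := fun θ => by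
    simp [hf', polarSpeed, levelRadius_periodic, polarDen, hper θ]
  obtain ⟨c, hc, hcf⟩ := exists_pos_le_of_periodic Real.two_pi_pos hf'c hf'p fun θ =>
    div_pos (pow_pos (hρpos θ) 2) (hpos θ)
  have hτ : ∀ x, HasDerivAt (fun x => ∫ s in (0 : ℝ)..x, f' s) (f' x) x := fun x =>
    intervalIntegral.integral_hasDerivAt_right (hf'c.intervalIntegrable _ _)
      hf'c.aestronglyMeasurable.stronglyMeasurableAtFilter hf'c.continuousAt
  obtain ⟨φ, hφ1, hφ2, hφd⟩ := exists_inverse_of_deriv_ge hc hτ hcf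
  have hτper : ∀ x, ∫ s in (0 : ℝ)..(x + 2 * Real.pi), f' s =
      (∫ s in (0 : ℝ)..x, f' s) + ∫ s in (0 : ℝ)..2 * Real.pi, f' s := fun x => by
    rw [← intervalIntegral.integral_add_adjacent_intervals (hf'c.intervalIntegrable 0 x)
      (hf'c.intervalIntegrable _ _), hf'p.intervalIntegral_add_eq x 0, zero_add]
  have hTpos : 0 < ∫ s in (0 : ℝ)..2 * Real.pi, f' s :=
    intervalIntegral.intervalIntegral_pos_of_pos (hf'c.intervalIntegrable _ _)
      (fun x => hc.trans_le (hcf x)) Real.two_pi_pos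
  have hφper : ∀ t, φ (t + ∫ s in (0 : ℝ)..2 * Real.pi, f' s) = φ t + 2 * Real.pi := fun t => by
    conv_lhs => rw [← hφ2 t, ← hτper, hφ1]
  refine ⟨fun t => levelPoint G R₀ (φ t) (h (φ t)), fun t => ?_, ⟨_, hTpos, fun t => ?_⟩,
    ⟨∫ s in (0 : ℝ)..0, f' s, ∫ s in (0 : ℝ)..Real.pi, f' s, ?_⟩, ?_⟩
  · refine ((hG.hasDerivAt_levelPoint hh hH hpos (φ t)).scomp t (hφd t)).congr_deriv ?_
    rw [smul_smul, inv_mul_cancel₀ (hc.trans_le (hcf _)).ne', one_smul]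
  · simp only [hφper, levelPoint, levelRadius_periodic, hper (φ t), Real.sin_add_two_pi,
      Real.cos_add_two_pi]
  · simp only [hφ1, levelPoint]
    intro he
    have := congrArg Prod.snd he
    simp only [Real.cos_zero, Real.cos_pi] at this
    linarith [hρpos 0, hρpos Real.pi]
  · have hs : Function.Surjective φ := fun θ => ⟨_, hφ1 θ⟩
    exact (hs.range_comp fun θ => levelPoint G R₀ θ (h θ)).symm

end RadialPotential

/-- A polar angle for a curve avoiding the origin. -/
theorem exists_hasDerivAt_angle {x y x' y' : ℝ → ℝ} (hx : ∀ t, HasDerivAt x (x' t) t)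
    (hy : ∀ t, HasDerivAt y (y' t) t) (hx'c : Continuous x') (hy'c : Continuous y')
    (hpos : ∀ t, 0 < x t ^ 2 + y t ^ 2) :
    ∃ θ : ℝ → ℝ, (∀ t, HasDerivAt θ ((y t * x' t - x t * y' t) / (x t ^ 2 + y t ^ 2)) t) ∧
      ∀ t, x t = √(x t ^ 2 + y t ^ 2) * Real.sin (θ t) ∧
        y t = √(x t ^ 2 + y t ^ 2) * Real.cos (θ t) := by
  have hxc : Continuous x := continuous_iff_continuousAt.2 fun t => (hx t).continuousAt
  have hyc : Continuous y := continuous_iff_continuousAt.2 fun t => (hy t).continuousAt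
  set ω : ℝ → ℝ := fun t => (y t * x' t - x t * y' t) / (x t ^ 2 + y t ^ 2) with hω
  have hωc : Continuous ω := by
    refine Continuous.div (by fun_prop) (by fun_prop) fun t => (hpos t).ne'
  obtain ⟨θ₀, r₀, hr₀, hp⟩ := exists_polar (x 0, y 0)
  obtain ⟨hx0, hy0⟩ := Prod.mk.inj hp
  have hr₀eq : √(x 0 ^ 2 + y 0 ^ 2) = r₀ := by
    rw [hx0, hy0, ← Real.sqrt_sq hr₀]
    congr 1
    rw [Real.sqrt_sq hr₀]
    linear_combination r₀ ^ 2 * Real.sin_sq_add_cos_sq θ₀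
  set θ : ℝ → ℝ := fun t => θ₀ + ∫ s in (0 : ℝ)..t, ω s with hθ
  have hθd : ∀ t, HasDerivAt θ (ω t) t := fun t =>
    (intervalIntegral.integral_hasDerivAt_right (hωc.intervalIntegrable _ _)
      hωc.aestronglyMeasurable.stronglyMeasurableAtFilter hωc.continuousAt).const_add θ₀
  have hrd : ∀ t, HasDerivAt (fun t => √(x t ^ 2 + y t ^ 2))
      ((x t * x' t + y t * y' t) / √(x t ^ 2 + y t ^ 2)) t := fun t => by
    refine ((((hx t).pow 2).add ((hy t).pow 2)).sqrt (hpos t).ne').congr_deriv ?_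
    have := (Real.sqrt_pos.2 (hpos t)).ne'
    simp only [Pi.add_apply, Pi.pow_apply]
    field_simp
    norm_num
    ring
  have hA : ∀ t, HasDerivAt (fun t => (x t * Real.cos (θ t) - y t * Real.sin (θ t)) /
      √(x t ^ 2 + y t ^ 2)) 0 t := fun t => by
    have hs := (Real.sqrt_pos.2 (hpos t)).ne'
    have hsq := Real.sq_sqrt (hpos t).le
    refine ((((hx t).mul (hθd t).cos).sub ((hy t).mul (hθd t).sin)).div (hrd t) hs).congr_deriv ?_
    simp only [Pi.mul_apply, Pi.sub_apply, hω]
    rw [← hsq]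
    field_simp
    rw [hsq]
    linear_combination (x' t * Real.cos (θ t) * x t ^ 2 - x' t * x t * y t * Real.sin (θ t) +
      Real.cos (θ t) * x t * y t * y' t - y t ^ 2 * Real.sin (θ t) * y' t) * hsq
  have hB : ∀ t, HasDerivAt (fun t => (x t * Real.sin (θ t) + y t * Real.cos (θ t)) /
      √(x t ^ 2 + y t ^ 2)) 0 t := fun t => by
    have hs := (Real.sqrt_pos.2 (hpos t)).ne'
    have hsq := Real.sq_sqrt (hpos t).le
    refine ((((hx t).mul (hθd t).sin).add ((hy t).mul (hθd t).cos)).div (hrd t) hs).congr_deriv ?_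
    simp only [Pi.mul_apply, Pi.add_apply, hω]
    rw [← hsq]
    field_simp
    rw [hsq]
    linear_combination (x' t * Real.sin (θ t) * x t ^ 2 + x' t * x t * y t * Real.cos (θ t) +
      Real.sin (θ t) * x t * y t * y' t + y t ^ 2 * Real.cos (θ t) * y' t) * hsq
  have hconst : ∀ f : ℝ → ℝ, (∀ t, HasDerivAt f 0 t) → ∀ t, f t = f 0 := fun f hf t =>
    is_const_of_deriv_eq_zero (fun t => (hf t).differentiableAt) (fun t => (hf t).deriv) t 0
  have hθ0 : θ 0 = θ₀ := by simp [hθ]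
  have hr₀pos : 0 < r₀ := by
    rw [← hr₀eq]
    exact Real.sqrt_pos.2 (hpos 0)
  refine ⟨θ, hθd, fun t => ?_⟩
  have h1 := hconst _ hA t
  have h2 := hconst _ hB t
  have hs := (Real.sqrt_pos.2 (hpos t)).ne'
  rw [hθ0, hr₀eq, hx0, hy0, div_eq_iff hs] at h1 h2
  have e1 : (r₀ * Real.sin θ₀ * Real.cos θ₀ - r₀ * Real.cos θ₀ * Real.sin θ₀) / r₀ = 0 := by
    ring
  have e2 : (r₀ * Real.sin θ₀ * Real.sin θ₀ + r₀ * Real.cos θ₀ * Real.cos θ₀) / r₀ = 1 := by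
    rw [div_eq_one_iff_eq hr₀pos.ne']
    linear_combination r₀ * Real.sin_sq_add_cos_sq θ₀
  rw [e1, zero_mul] at h1
  rw [e2, one_mul] at h2
  have hcs := Real.sin_sq_add_cos_sq (θ t)
  constructor
  · rw [← h2]
    linear_combination Real.cos (θ t) * h1 - x t * hcs
  · rw [← h2]
    linear_combination -Real.sin (θ t) * h1 - y t * hcs

/-- The Hamiltonian `y ^ 2 / 2 + G(x)`. -/
noncomputable def planarHam (G : ℝ → ℝ) (p : ℝ × ℝ) : ℝ :=
  p.2 ^ 2 / 2 + G p.1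

namespace RadialPotential

variable {G g F₂ F₁ : ℝ → ℝ} {R₀ H₀ l m : ℝ}

theorem planarHam_levelPoint (hG : RadialPotential G g R₀ H₀) {θ h : ℝ} (hh : H₀ < h) :
    planarHam G (levelPoint G R₀ θ h) = h :=
  hG.polarHam_levelRadius hh

theorem exists_scalar_solution (hG : RadialPotential G g R₀ H₀) (hF₂ : Continuous F₂)
    (hF₁ : Continuous F₁) {W : Set ℝ} (hW : ∀ h ∈ W, H₀ < h)
    (hpos : ∀ h ∈ W, ∀ θ, 0 < polarSpeed G g F₂ F₁ R₀ (θ, h, l, m)) {γ : ℝ → ℝ × ℝ}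
    (hγ : ∀ t, HasDerivAt γ (planarField g F₂ F₁ l m (γ t)) t) {T : ℝ} (hT : 0 < T)
    (hper : Function.Periodic γ T) (hin : ∀ t, planarHam G (γ t) ∈ W) :
    ∃ k : ℝ → ℝ, (∀ θ, HasDerivAt k (polarRhs G g F₂ F₁ R₀ (θ, k θ, l, m)) θ) ∧
      (∀ θ, k θ ∈ W) ∧ Set.range γ = Set.range fun θ => levelPoint G R₀ θ (k θ) := by
  have hgc := hG.contDiff.continuous
  have hγc : Continuous γ := continuous_iff_continuousAt.2 fun t => (hγ t).continuousAt
  have hx : ∀ t, HasDerivAt (fun t => (γ t).1)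
      ((γ t).2 - (l * F₂ (γ t).1 + m * F₁ (γ t).1)) t := fun t => (hγ t).fst
  have hy : ∀ t, HasDerivAt (fun t => (γ t).2) (-g (γ t).1) t := fun t => (hγ t).snd
  have hout : ∀ t, R₀ < √((γ t).1 ^ 2 + (γ t).2 ^ 2) := fun t => by
    obtain ⟨θ, r, hr, hp⟩ := exists_polar (γ t)
    have h1 : (γ t).1 ^ 2 + (γ t).2 ^ 2 = r ^ 2 := by
      rw [hp]
      linear_combination r ^ 2 * Real.sin_sq_add_cos_sq θ
    rw [h1, Real.sqrt_sq hr]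
    by_contra! hle
    have h2 := hG.le θ r hr hle
    have h3 := hW _ (hin t)
    rw [hp] at h3
    exact absurd h3 (not_lt.2 h2)
  have hsq : ∀ t, 0 < (γ t).1 ^ 2 + (γ t).2 ^ 2 := fun t =>
    Real.sqrt_pos.1 (hG.pos.trans (hout t))
  obtain ⟨θ, hθd, hθ⟩ := exists_hasDerivAt_angle hx hy (by fun_prop) (by fun_prop) hsq
  have hpoint : ∀ t, γ t = (√((γ t).1 ^ 2 + (γ t).2 ^ 2) * Real.sin (θ t),
      √((γ t).1 ^ 2 + (γ t).2 ^ 2) * Real.cos (θ t)) := fun t =>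
    Prod.ext (hθ t).1 (hθ t).2
  have hham : ∀ t, planarHam G (γ t) = polarHam G (θ t) √((γ t).1 ^ 2 + (γ t).2 ^ 2) := fun t => by
    conv_lhs => rw [hpoint t]
    rfl
  have hrad : ∀ t, levelRadius G R₀ (θ t) (planarHam G (γ t)) = √((γ t).1 ^ 2 + (γ t).2 ^ 2) :=
    fun t => by
    rw [hham]
    exact hG.levelRadius_eq (hout t) (by rw [← hham]; exact hW _ (hin t))
  have hlp : ∀ t, levelPoint G R₀ (θ t) (planarHam G (γ t)) = γ t := fun t => by
    rw [levelPoint, hrad]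
    exact (hpoint t).symm
  set ω : ℝ → ℝ := fun t => ((γ t).2 * ((γ t).2 - (l * F₂ (γ t).1 + m * F₁ (γ t).1)) -
    (γ t).1 * -g (γ t).1) / ((γ t).1 ^ 2 + (γ t).2 ^ 2) with hω
  have hspeed : ∀ t, polarSpeed G g F₂ F₁ R₀ (θ t, planarHam G (γ t), l, m) =
      (γ t).2 * ((γ t).2 - (l * F₂ (γ t).1 + m * F₁ (γ t).1)) - (γ t).1 * -g (γ t).1 :=
    fun t => by
    simp only [polarSpeed, polarDen, hrad, ← (hθ t).1, ← (hθ t).2]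
    ring
  have hωpos : ∀ t, 0 < ω t := fun t => by
    refine div_pos ?_ (hsq t)
    rw [← hspeed]
    exact hpos _ (hin t) _
  have hωc : Continuous ω := Continuous.div (by fun_prop) (by fun_prop) fun t => (hsq t).ne'
  obtain ⟨c, hc, hcω⟩ := exists_pos_le_of_periodic hT hωc (fun t => by simp [hω, hper t]) hωpos
  obtain ⟨φ, hφ1, hφ2, hφd⟩ := exists_inverse_of_deriv_ge hc hθd hcω
  have hHd : ∀ t, HasDerivAt (fun t => planarHam G (γ t))
      (-(g (γ t).1 * (l * F₂ (γ t).1 + m * F₁ (γ t).1))) t := fun t => by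
    refine ((((hy t).pow 2).div_const 2).add ((hG.hasDerivAt _).comp t (hx t))).congr_deriv ?_
    norm_num
    ring
  refine ⟨fun s => planarHam G (γ (φ s)), fun s => ?_, fun s => hin _, ?_⟩
  · refine ((hHd (φ s)).comp s (hφd s)).congr_deriv ?_
    have h1 := hspeed (φ s)
    have h2 : polarRhs G g F₂ F₁ R₀ (θ (φ s), planarHam G (γ (φ s)), l, m) =
        (l * F₂ (γ (φ s)).1 + m * F₁ (γ (φ s)).1) * -g (γ (φ s)).1 *
          √((γ (φ s)).1 ^ 2 + (γ (φ s)).2 ^ 2) ^ 2 /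
          polarSpeed G g F₂ F₁ R₀ (θ (φ s), planarHam G (γ (φ s)), l, m) := by
      simp only [polarRhs, polarSpeed, hrad, ← (hθ _).1]
    rw [hφ2] at h1 h2
    rw [h2, h1, Real.sq_sqrt (hsq _).le, inv_div]
    ring
  · have hs : Function.Surjective φ := fun t => ⟨_, hφ1 t⟩
    rw [← hs.range_comp γ]
    congr 1
    funext s
    have := hlp (φ s)
    rw [hφ2] at this
    exact this.symm

end RadialPotential

namespace RadialPotential

variable {G g F₂ F₁ : ℝ → ℝ} {R₀ H₀ z : ℝ}

theorem exists_isLimitCycle (hG : RadialPotential G g R₀ H₀) (hF₂ : ContDiff ℝ 2 F₂)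
    (hF₁ : ContDiff ℝ 2 F₁) (hF₂e : ∀ x, F₂ (-x) = F₂ x) (hF₁o : ∀ x, F₁ (-x) = -F₁ x)
    (hz : H₀ < z) (hM : ∫ θ in (0 : ℝ)..Real.pi, mCoeff (polarRhs G g F₂ F₁ R₀) θ z = 0)
    (hM' : ∫ θ in (0 : ℝ)..Real.pi, mCoeff (hDeriv (polarRhs G g F₂ F₁ R₀)) θ z ≠ 0) :
    ∃ η₀ > 0, ∀ η, 0 < η → η ≤ η₀ → ∃ ε₀ > 0, ∀ l m, |l| ≤ ε₀ → m ≠ 0 → |m| ≤ ε₀ →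
      ∃ Γ, IsLimitCycle (planarField g F₂ F₁ l m) Γ ∧ ∀ p ∈ Γ, |planarHam G p - z| < η := by
  have hR := hG.reversibleField hF₂ hF₁ hF₂e hF₁o hz
  obtain ⟨η₁, hη₁, huniq⟩ := hR.exists_unique_bounded_solution hM'
  obtain ⟨η₂, hη₂, hex⟩ := hR.exists_periodic_near hM hM'
  obtain ⟨δ, hδ, hpos⟩ := Metric.eventually_nhds_iff.1
    (hG.eventually_polarSpeed_pos hF₂.continuous hF₁.continuous hz)
  have hspeed : ∀ h l m, |h - z| < δ → |l| < δ → |m| < δ →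
      ∀ θ, 0 < polarSpeed G g F₂ F₁ R₀ (θ, h, l, m) := fun h l m h1 h2 h3 => by
    refine hpos (y := (h, l, m)) ?_
    simp only [Prod.dist_eq, Real.dist_eq, sub_zero]
    exact max_lt h1 (max_lt h2 h3)
  refine ⟨min (min η₁ η₂) (min δ (z - H₀)), by
    have := sub_pos.2 hz
    positivity, fun η hη hηle => ?_⟩
  obtain ⟨⟨hle1, hle2⟩, hle3, hle4⟩ := by simpa only [le_min_iff] using hηle
  obtain ⟨ε, hε, hsol⟩ := hex η hη hle2
  refine ⟨min ε (min (η₁ / 2) (δ / 2)), by positivity, fun l m hl hm0 hm => ?_⟩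
  obtain ⟨hl1, hl2, hl3⟩ := by simpa only [le_min_iff] using hl
  obtain ⟨hm1, hm2, hm3⟩ := by simpa only [le_min_iff] using hm
  obtain ⟨h, hper, hd, hnear⟩ := hsol l m hl1 hm0 hm1
  have hW : ∀ k ∈ {k : ℝ | |k - z| < η}, H₀ < k := fun k hk => by
    have hk' : |k - z| < η := hk
    have := (abs_lt.1 hk').1
    linarith
  have hWpos : ∀ k ∈ {k : ℝ | |k - z| < η}, ∀ θ, 0 < polarSpeed G g F₂ F₁ R₀ (θ, k, l, m) :=
    fun k hk => hspeed k l m (lt_of_lt_of_le hk hle3) (by linarith) (by linarith)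
  have hpt : ∀ p ∈ Set.range fun θ => levelPoint G R₀ θ (h θ), |planarHam G p - z| < η := by
    rintro _ ⟨θ, rfl⟩
    simp only [hG.planarHam_levelPoint (hW _ (hnear θ))]
    exact hnear θ
  have hGc := hG.contDiff_potential.continuous
  refine ⟨_, ⟨hG.isPeriodicOrbit_levelPoint hF₂.continuous hF₁.continuous hd
    (fun θ => hW _ (hnear θ)) (fun θ => hWpos _ (hnear θ) θ) hper,
    {p | |planarHam G p - z| < η}, ?_, hpt, ?_⟩, hpt⟩
  · refine isOpen_lt ?_ continuous_const
    unfold planarHam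
    fun_prop
  · rintro _ ⟨γ, hγ, ⟨T, hT, hγT⟩, -, rfl⟩ hsub
    obtain ⟨k, hk, hkW, hrange⟩ := hG.exists_scalar_solution hF₂.continuous hF₁.continuous hW
      hWpos hγ hT hγT fun t => hsub ⟨t, rfl⟩
    have hkh : k = h := huniq l m k h (by linarith) (by linarith) hm0 hk
      (fun θ => lt_of_lt_of_le (hkW θ) hle1) hd fun θ => lt_of_lt_of_le (hnear θ) hle1
    rw [hrange, hkh]

end RadialPotential

/-- The critical values of a differentiable real function form a null set. -/
theorem volume_image_critical_eq_zero {f f' : ℝ → ℝ} {s : Set ℝ}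
    (hf : ∀ x ∈ s, HasDerivAt f (f' x) x) (hf' : ∀ x ∈ s, f' x = 0) :
    MeasureTheory.volume (f '' s) = 0 := by
  refine MeasureTheory.addHaar_image_eq_zero_of_det_fderivWithin_eq_zero MeasureTheory.volume
    (f' := fun x => ContinuousLinearMap.toSpanSingleton ℝ (f' x))
    (fun x hx => (hf x hx).hasFDerivAt.hasFDerivWithinAt) fun x hx => ?_
  rw [hf' x hx]
  simp [ContinuousLinearMap.det]

theorem exists_alternating_combination {M : ℕ → ℝ → ℝ} (hpos : ∀ j, ∀ᶠ h in atTop, 0 < M j h)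
    (hlit : ∀ j, M j =o[atTop] M (j + 1)) (H₁ : ℝ) (q : ℕ) :
    ∃ b h : ℕ → ℝ, (∀ j ≤ q, b j ≠ 0) ∧ (∀ i ≤ q, H₁ < h i) ∧ (∀ i < q, h i < h (i + 1)) ∧
      ∀ i ≤ q, 0 < (-1) ^ i * ∑ j ∈ Finset.range (q + 1), b j * M j (h i) := by
  induction q with
  | zero =>
    obtain ⟨h, h1, h2⟩ := ((hpos 0).and (eventually_gt_atTop H₁)).exists
    exact ⟨fun _ => 1, fun _ => h, by simp, fun _ _ => h2, by simp, by simpa using h1⟩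
  | succ q ih =>
    obtain ⟨b, h, hb, hH, hmono, hsgn⟩ := ih
    have hev : ∀ᶠ t : ℝ in 𝓝[>] 0, ∀ i ∈ Finset.range (q + 1),
        0 < (-1) ^ i * ((∑ j ∈ Finset.range (q + 1), b j * M j (h i)) +
          (-1) ^ (q + 1) * t * M (q + 1) (h i)) := by
      rw [Filter.eventually_all_finset]
      intro i hi
      refine Filter.Eventually.filter_mono nhdsWithin_le_nhds ?_
      have hc : ContinuousAt (fun t : ℝ => (-1) ^ i *
          ((∑ j ∈ Finset.range (q + 1), b j * M j (h i)) +
          (-1) ^ (q + 1) * t * M (q + 1) (h i))) 0 := by fun_prop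
      refine hc.eventually_const_lt ?_
      simpa using hsgn i (Finset.mem_range_succ_iff.1 hi)
    obtain ⟨t, ht, ht0⟩ := (hev.and self_mem_nhdsWithin).exists
    have ht0 : 0 < t := ht0
    have hlt : ∀ k j, j < k → M j =o[atTop] M k := by
      intro k
      induction k with
      | zero => simp
      | succ k ihk =>
        intro j hj
        rcases Nat.lt_succ_iff_lt_or_eq.1 hj with h' | rfl
        · exact (ihk j h').trans (hlit k)
        · exact hlit j
    have hsum : (fun x => ∑ j ∈ Finset.range (q + 1), b j * M j x) =o[atTop] M (q + 1) :=
      Asymptotics.IsLittleO.fun_sum fun j hj => (hlt _ j (Finset.mem_range.1 hj)).const_mul_left _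
    obtain ⟨x, ⟨hx1, hx2⟩, hx3, hx4⟩ := ((hsum.def (half_pos ht0)).and (hpos (q + 1))).and
      ((eventually_gt_atTop H₁).and (eventually_gt_atTop (h q))) |>.exists
    refine ⟨Function.update b (q + 1) ((-1) ^ (q + 1) * t), Function.update h (q + 1) x,
      fun j hj => ?_, fun i hi => ?_, fun i hi => ?_, fun i hi => ?_⟩
    · rcases eq_or_ne j (q + 1) with rfl | hne
      · simp [ht0.ne']
      · rw [Function.update_of_ne hne]
        exact hb j (by omega)
    · rcases eq_or_ne i (q + 1) with rfl | hne
      · simpa using hx3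
      · rw [Function.update_of_ne hne]
        exact hH i (by omega)
    · rw [Function.update_of_ne hi.ne]
      rcases eq_or_ne i q with rfl | hne
      · simpa using hx4
      · rw [Function.update_of_ne (by omega)]
        exact hmono i (by omega)
    · rw [Finset.sum_range_succ, Function.update_self]
      have hcongr : ∀ y, ∑ j ∈ Finset.range (q + 1),
          Function.update b (q + 1) ((-1) ^ (q + 1) * t) j * M j y =
          ∑ j ∈ Finset.range (q + 1), b j * M j y := fun y =>
        Finset.sum_congr rfl fun j hj => by
          rw [Function.update_of_ne (Finset.mem_range.1 hj).ne]
      rw [hcongr]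
      rcases eq_or_ne i (q + 1) with rfl | hne
      · rw [Function.update_self, mul_add, ← mul_assoc, ← mul_assoc, ← pow_add, ← two_mul]
        simp only [even_two, Even.mul_right, Even.neg_pow, one_pow, one_mul]
        rw [Real.norm_eq_abs, Real.norm_eq_abs, abs_of_pos hx2] at hx1
        have h1 : |(-1 : ℝ) ^ (q + 1) * ∑ j ∈ Finset.range (q + 1), b j * M j x| ≤
            t / 2 * M (q + 1) x := by
          rw [abs_mul, abs_pow, abs_neg, abs_one, one_pow, one_mul]
          exact hx1
        have h2 := (abs_le.1 h1).1
        have := mul_pos ht0 hx2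
        linarith
      · rw [Function.update_of_ne hne]
        exact ht i (Finset.mem_range.2 (by omega))

theorem exists_simple_zeros {M : ℕ → ℝ → ℝ} {H₀ : ℝ}
    (hd : ∀ j, ∀ h, H₀ < h → DifferentiableAt ℝ (M j) h)
    (hpos0 : ∀ h, H₀ < h → 0 < M 0 h)
    (hpos : ∀ j, ∀ᶠ h in atTop, 0 < M j h)
    (hlit : ∀ j, M j =o[atTop] M (j + 1)) (q : ℕ) :
    ∃ b : ℕ → ℝ, (∀ j ≤ q, b j ≠ 0) ∧ ∃ z : Fin q → ℝ, Function.Injective z ∧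
      ∀ i, H₀ < z i ∧ ∑ j ∈ Finset.range (q + 1), b j * M j (z i) = 0 ∧
        deriv (fun h => ∑ j ∈ Finset.range (q + 1), b j * M j h) (z i) ≠ 0 := by
  obtain ⟨b, h, hb, hH, hmono, hsgn⟩ := exists_alternating_combination hpos hlit H₀ q
  set N : ℝ → ℝ := fun x => ∑ j ∈ Finset.range q, b (j + 1) * M (j + 1) x with hN
  have hNd : ∀ x, H₀ < x → DifferentiableAt ℝ N x := fun x hx =>
    DifferentiableAt.fun_sum fun j _ => (hd _ x hx).const_mul _
  set f : ℝ → ℝ := fun x => N x / M 0 x with hf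
  have hfd : ∀ x, H₀ < x → DifferentiableAt ℝ f x := fun x hx =>
    (hNd x hx).div (hd 0 x hx) (hpos0 x hx).ne'
  have hnull := volume_image_critical_eq_zero (f := f) (f' := deriv f)
    (s := {x | H₀ < x ∧ deriv f x = 0}) (fun x hx => (hfd x hx.1).hasDerivAt) fun x hx => hx.2
  have hdense : Dense (f '' {x | H₀ < x ∧ deriv f x = 0})ᶜ :=
    MeasureTheory.Measure.dense_of_ae (MeasureTheory.measure_eq_zero_iff_ae_notMem.1 hnull)
  have hev : ∀ᶠ c : ℝ in 𝓝 (-b 0), c ≠ 0 ∧ ∀ i ∈ Finset.range (q + 1),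
      0 < (-1) ^ i * (N (h i) + -c * M 0 (h i)) := by
    refine Filter.Eventually.and (eventually_ne_nhds (neg_ne_zero.2 (hb 0 (Nat.zero_le _)))) ?_
    rw [Filter.eventually_all_finset]
    intro i hi
    have hc : ContinuousAt (fun c : ℝ => (-1) ^ i * (N (h i) + -c * M 0 (h i))) (-b 0) := by
      fun_prop
    refine hc.eventually_const_lt ?_
    have := hsgn i (Finset.mem_range_succ_iff.1 hi)
    rw [Finset.sum_range_succ'] at this
    simpa using this
  obtain ⟨c, hc, hc0, hcs⟩ := ((mem_closure_iff_frequently.1 (hdense (-b 0))).and_eventually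
    hev).exists
  set b' : ℕ → ℝ := Function.update b 0 (-c) with hb'
  have hsum : ∀ x, ∑ j ∈ Finset.range (q + 1), b' j * M j x = N x + -c * M 0 x := fun x => by
    rw [Finset.sum_range_succ']
    simp [hb', hN]
  have hNc : ∀ x, H₀ < x → DifferentiableAt ℝ (fun x => N x + -c * M 0 x) x := fun x hx =>
    (hNd x hx).add ((hd 0 x hx).const_mul _)
  have hzero : ∀ i : Fin q, ∃ z, h i < z ∧ z < h (i + 1) ∧ N z + -c * M 0 z = 0 := by
    intro i
    have hi := i.2
    have hlt := hmono i hi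
    have h1 := hcs i (Finset.mem_range.2 (by omega))
    have h2 := hcs (i + 1) (Finset.mem_range.2 (by omega))
    have hcont : ContinuousOn (fun x => N x + -c * M 0 x) (Set.Icc (h i) (h (i + 1))) :=
      fun x hx => (hNc x ((hH i (by omega)).trans_le hx.1)).continuousAt.continuousWithinAt
    rw [pow_succ] at h2
    rcases neg_one_pow_eq_or ℝ (i : ℕ) with hs | hs <;> rw [hs] at h1 h2
    · obtain ⟨z, hz, hz0⟩ := intermediate_value_Ioo' hlt.le hcont
        (show (0 : ℝ) ∈ Set.Ioo _ _ from ⟨by linarith, by linarith⟩)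
      exact ⟨z, hz.1, hz.2, hz0⟩
    · obtain ⟨z, hz, hz0⟩ := intermediate_value_Ioo hlt.le hcont
        (show (0 : ℝ) ∈ Set.Ioo _ _ from ⟨by linarith, by linarith⟩)
      exact ⟨z, hz.1, hz.2, hz0⟩
  choose z hz1 hz2 hz0 using hzero
  have hle : ∀ i j : ℕ, i ≤ j → j ≤ q → h i ≤ h j := by
    intro i j hij
    induction j, hij using Nat.le_induction with
    | base => simp
    | succ j _ ih =>
      intro hj
      exact (ih (by omega)).trans (hmono j (by omega)).le
  have hzlt : ∀ i j : Fin q, i < j → z i < z j := fun i j hij =>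
    (hz2 i).trans_le ((hle _ _ (Nat.succ_le_of_lt hij) j.2.le).trans (hz1 j).le)
  refine ⟨b', fun j hj => ?_, z, (show StrictMono z from hzlt).injective, fun i => ?_⟩
  · rcases eq_or_ne j 0 with rfl | hne
    · simpa [hb'] using hc0
    · rw [hb', Function.update_of_ne hne]
      exact hb j hj
  have hzH : H₀ < z i := (hH i i.2.le).trans (hz1 i)
  refine ⟨hzH, by rw [hsum, hz0], fun hderiv => hc ⟨z i, ⟨hzH, ?_⟩, ?_⟩⟩
  · rw [show (fun h => ∑ j ∈ Finset.range (q + 1), b' j * M j h) = fun x => N x + -c * M 0 x from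
      funext hsum] at hderiv
    have h1 := ((hNd _ hzH).hasDerivAt.add ((hd 0 _ hzH).hasDerivAt.const_mul (-c))).deriv
    have h3 : deriv N (z i) + -c * deriv (M 0) (z i) = 0 := h1.symm.trans hderiv
    have h2 := ((hNd _ hzH).hasDerivAt.div (hd 0 _ hzH).hasDerivAt (hpos0 _ hzH).ne').deriv
    refine (show deriv f (z i) = _ from h2).trans ?_
    have h4 : deriv N (z i) * M 0 (z i) - N (z i) * deriv (M 0) (z i) = 0 := by
      linear_combination M 0 (z i) * h3 - deriv (M 0) (z i) * hz0 i
    rw [h4, zero_div]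
  · rw [hf]
    simp only
    rw [div_eq_iff (hpos0 _ hzH).ne']
    linear_combination hz0 i

/-- The density `x g(x) r ^ 2 / (y ^ 2 + x g(x))` at the point of height `h` and angle `θ`. -/
noncomputable def levelWeight (G g : ℝ → ℝ) (R₀ θ h : ℝ) : ℝ :=
  let r := levelRadius G R₀ θ h
  r * Real.sin θ * g (r * Real.sin θ) * r ^ 2 / polarDen g θ r

/-- The even moments of `x` with respect to `levelWeight`. -/
noncomputable def levelMoment (G g : ℝ → ℝ) (R₀ : ℝ) (j : ℕ) (h : ℝ) : ℝ :=
  ∫ θ in (0 : ℝ)..Real.pi, (levelRadius G R₀ θ h * Real.sin θ) ^ (2 * j) * levelWeight G g R₀ θ h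

namespace RadialPotential

variable {G g : ℝ → ℝ} {R₀ H₀ c X₀ C : ℝ}

theorem continuous_levelRadius (hG : RadialPotential G g R₀ H₀) {h : ℝ} (hh : H₀ < h) :
    Continuous fun θ => levelRadius G R₀ θ h :=
  continuous_iff_continuousAt.2 fun θ =>
    ContinuousAt.comp (g := fun p : ℝ × ℝ => levelRadius G R₀ p.1 p.2) (f := fun θ => (θ, h))
      (hG.contDiffAt_levelRadius hh).continuousAt (by fun_prop)

theorem continuous_levelWeight (hG : RadialPotential G g R₀ H₀) {h : ℝ} (hh : H₀ < h) :
    Continuous fun θ => levelWeight G g R₀ θ h := by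
  have hr := hG.continuous_levelRadius hh
  have hg := hG.contDiff.continuous
  unfold levelWeight
  refine Continuous.div (by fun_prop) (by unfold polarDen; fun_prop) fun θ => ?_
  exact (hG.den_pos θ _ (hG.lt_levelRadius hh).le).ne'

theorem eventually_lt_levelRadius (hG : RadialPotential G g R₀ H₀) (r : ℝ) :
    ∀ᶠ h in atTop, H₀ < h ∧ ∀ θ, r < levelRadius G R₀ θ h := by
  obtain ⟨B, hB⟩ := (isCompact_Icc (a := -r) (b := r)).bddAbove_image (f := G)
    hG.contDiff_potential.continuous.continuousOn
  filter_upwards [eventually_gt_atTop H₀, eventually_gt_atTop (r ^ 2 / 2 + B)] with h h1 h2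
  refine ⟨h1, fun θ => ?_⟩
  by_contra! hle
  have h0 : 0 < levelRadius G R₀ θ h := hG.pos.trans (hG.lt_levelRadius h1)
  have h3 := hG.polarHam_levelRadius (θ := θ) h1
  generalize levelRadius G R₀ θ h = ρ at *
  have h4 : |ρ * Real.sin θ| ≤ r := by
    rw [abs_mul, abs_of_pos h0]
    nlinarith [Real.abs_sin_le_one θ, abs_nonneg (Real.sin θ)]
  have h5 := hB (Set.mem_image_of_mem G (abs_le.1 h4))
  have h6 : (ρ * Real.cos θ) ^ 2 ≤ r ^ 2 := by
    rw [mul_pow]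
    have : ρ ^ 2 ≤ r ^ 2 := by gcongr
    nlinarith [Real.cos_sq_le_one θ, sq_nonneg r, sq_nonneg (Real.cos θ)]
  unfold polarHam at h3
  linarith

theorem levelWeight_ge (hG : RadialPotential G g R₀ H₀) (hg : CoerciveForce g c X₀ C) {θ h : ℝ}
    (hh : H₀ < h) (hx : X₀ ≤ |levelRadius G R₀ θ h * Real.sin θ|) :
    c * (levelRadius G R₀ θ h * Real.sin θ) ^ 2 ≤ levelWeight G g R₀ θ h := by
  have hD := hG.den_pos θ _ (hG.lt_levelRadius (θ := θ) hh).le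
  have h1 := hg.quadratic _ hx
  unfold levelWeight
  simp only
  rw [le_div_iff₀ hD]
  unfold polarDen at *
  generalize levelRadius G R₀ θ h = ρ at *
  have hr : ρ ^ 2 = (ρ * Real.sin θ) ^ 2 + (ρ * Real.cos θ) ^ 2 := by
    linear_combination -ρ ^ 2 * Real.sin_sq_add_cos_sq θ
  rw [hr]
  generalize ρ * Real.cos θ = y at *
  generalize ρ * Real.sin θ = x at *
  generalize x * g x = u at *
  have hc := hg.c_pos
  have hc1 := hg.c_le
  have hu : 0 ≤ u := le_trans (by positivity) h1
  nlinarith [mul_le_mul_of_nonneg_right h1 (sq_nonneg y),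
    mul_nonneg (mul_nonneg hu (sq_nonneg x)) (sub_nonneg.2 hc1)]

theorem eventually_abs_levelWeight_le (hG : RadialPotential G g R₀ H₀)
    (hg : CoerciveForce g c X₀ C) (K : ℝ) :
    ∃ A, 0 ≤ A ∧ ∀ᶠ h in atTop, ∀ θ, |levelRadius G R₀ θ h * Real.sin θ| ≤ K →
      |levelWeight G g R₀ θ h| ≤ A := by
  have hgc := hG.contDiff.continuous
  obtain ⟨B, hB⟩ := (isCompact_Icc (a := -K) (b := K)).bddAbove_image
    (f := fun x => |x * g x|) (by fun_prop)
  refine ⟨2 * max B 0, by positivity, ?_⟩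
  filter_upwards [hG.eventually_lt_levelRadius (2 * |K| + C + 2)] with h hh θ hx
  have hD := hG.den_pos θ _ (hG.lt_levelRadius (θ := θ) hh.1).le
  have hρ := hh.2 θ
  have h1 : |_| ≤ B := hB (Set.mem_image_of_mem _ (abs_le.1 hx))
  have h2 := hg.lower (levelRadius G R₀ θ h * Real.sin θ)
  have hC := hg.C_nonneg
  unfold levelWeight
  simp only
  rw [abs_div, abs_of_pos hD, div_le_iff₀ hD, abs_mul, abs_of_nonneg (sq_nonneg (levelRadius G R₀ θ h))]
  have hDge : levelRadius G R₀ θ h ^ 2 / 2 ≤ polarDen g θ (levelRadius G R₀ θ h) := by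
    unfold polarDen
    generalize levelRadius G R₀ θ h = ρ at *
    have hr : ρ ^ 2 = (ρ * Real.sin θ) ^ 2 + (ρ * Real.cos θ) ^ 2 := by
      linear_combination -ρ ^ 2 * Real.sin_sq_add_cos_sq θ
    have hx2 : (ρ * Real.sin θ) ^ 2 ≤ |K| ^ 2 :=
      sq_le_sq.2 (by rw [abs_abs]; exact hx.trans (le_abs_self K))
    have hρ2 : (2 * |K| + C + 2) ^ 2 ≤ ρ ^ 2 := by gcongr
    nlinarith [abs_nonneg K, mul_nonneg (abs_nonneg K) hC, sq_nonneg |K|]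
  calc |_| * levelRadius G R₀ θ h ^ 2 ≤ max B 0 * levelRadius G R₀ θ h ^ 2 := by
        gcongr
        exact h1.trans (le_max_left _ _)
    _ = 2 * max B 0 * (levelRadius G R₀ θ h ^ 2 / 2) := by ring
    _ ≤ _ := by gcongr

theorem levelMoment_succ_ge (hG : RadialPotential G g R₀ H₀) (hg : CoerciveForce g c X₀ C)
    (j : ℕ) {K : ℝ} (hK : X₀ ≤ K) :
    ∃ A, ∀ᶠ h in atTop,
      K ^ 2 * levelMoment G g R₀ j h - A ≤ levelMoment G g R₀ (j + 1) h := by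
  have hK0 : 0 < K := hg.X₀_pos.trans_le hK
  obtain ⟨A, hA, hev⟩ := hG.eventually_abs_levelWeight_le hg K
  refine ⟨K ^ (2 * j) * K ^ 2 * A * Real.pi, ?_⟩
  filter_upwards [hev, eventually_gt_atTop H₀] with h hw hh
  have hr := hG.continuous_levelRadius hh
  have hwc := hG.continuous_levelWeight hh
  have hint : ∀ i : ℕ, IntervalIntegrable (fun θ => (levelRadius G R₀ θ h * Real.sin θ) ^ (2 * i) *
      levelWeight G g R₀ θ h) MeasureTheory.volume 0 Real.pi := fun i => by
    apply Continuous.intervalIntegrable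
    fun_prop
  have hpt : ∀ θ, K ^ 2 * ((levelRadius G R₀ θ h * Real.sin θ) ^ (2 * j) *
      levelWeight G g R₀ θ h) - K ^ (2 * j) * K ^ 2 * A ≤
      (levelRadius G R₀ θ h * Real.sin θ) ^ (2 * (j + 1)) * levelWeight G g R₀ θ h := fun θ => by
    have hw' := hw θ
    have hge := hG.levelWeight_ge hg (θ := θ) hh
    generalize levelRadius G R₀ θ h * Real.sin θ = x at *
    generalize levelWeight G g R₀ θ h = w at *
    have hxp : (0 : ℝ) ≤ x ^ (2 * j) := by
      rw [pow_mul]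
      positivity
    rw [mul_add, pow_add]
    rcases le_total |x| K with hx | hx
    · have h1 := hw' hx
      have h2 : x ^ (2 * j) ≤ K ^ (2 * j) := by
        rw [pow_mul, pow_mul, ← sq_abs x]
        gcongr
      have h3 : |K ^ 2 - x ^ 2| ≤ K ^ 2 := by
        have : x ^ 2 ≤ K ^ 2 := by
          rw [← sq_abs x]
          gcongr
        rw [abs_of_nonneg (by linarith)]
        linarith [sq_nonneg x]
      have h4 : |x ^ (2 * j) * (K ^ 2 - x ^ 2) * w| ≤ K ^ (2 * j) * K ^ 2 * A := by
        rw [abs_mul, abs_mul, abs_of_nonneg hxp]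
        gcongr
      have := (abs_le.1 h4).2
      simp only [mul_one] at *
      linarith
    · have h1 := hge (hK.trans hx)
      have hw0 : 0 ≤ w := le_trans (mul_nonneg hg.c_pos.le (sq_nonneg x)) h1
      have h2 : K ^ 2 ≤ x ^ 2 := by
        rw [← sq_abs x]
        gcongr
      have h3 : 0 ≤ x ^ (2 * j) * (x ^ 2 - K ^ 2) * w :=
        mul_nonneg (mul_nonneg hxp (sub_nonneg.2 h2)) hw0
      have : 0 ≤ K ^ (2 * j) * K ^ 2 * A := by positivity
      simp only [mul_one] at *
      linarith
  have := intervalIntegral.integral_mono_on Real.pi_pos.le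
    (((hint j).const_mul (K ^ 2)).sub (intervalIntegrable_const (c := K ^ (2 * j) * K ^ 2 * A)))
    (hint (j + 1)) fun θ _ => hpt θ
  rw [intervalIntegral.integral_sub ((hint j).const_mul _) intervalIntegrable_const,
    intervalIntegral.integral_const_mul, intervalIntegral.integral_const] at this
  unfold levelMoment
  rw [smul_eq_mul] at this
  linarith

theorem tendsto_levelMoment_zero (hG : RadialPotential G g R₀ H₀) (hg : CoerciveForce g c X₀ C) :
    Tendsto (levelMoment G g R₀ 0) atTop atTop := by
  obtain ⟨A, hA, hev⟩ := hG.eventually_abs_levelWeight_le hg X₀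
  have hc := hg.c_pos
  refine tendsto_atTop.2 fun B => ?_
  have hlarge : ∀ᶠ r : ℝ in atTop,
      B ≤ c * r ^ 2 * (Real.pi / 2) - (A + c * X₀ ^ 2) * Real.pi := by
    have : Tendsto (fun r : ℝ => c * r ^ 2 * (Real.pi / 2) - (A + c * X₀ ^ 2) * Real.pi)
        atTop atTop := by
      refine tendsto_atTop_add_const_right _ _ ?_
      exact ((tendsto_pow_atTop (by norm_num)).const_mul_atTop hc).atTop_mul_const
        (by positivity)
    exact this.eventually_ge_atTop B
  obtain ⟨r, hr, hr0⟩ := (hlarge.and (eventually_ge_atTop 0)).exists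
  filter_upwards [hev, hG.eventually_lt_levelRadius r] with h hw ⟨hh, hrad⟩
  refine hr.trans ?_
  have hwc := hG.continuous_levelWeight hh
  have hpt : ∀ θ, c * r ^ 2 * Real.sin θ ^ 2 - (A + c * X₀ ^ 2) ≤ levelWeight G g R₀ θ h :=
    fun θ => by
    have hrθ := hrad θ
    have hx : c * r ^ 2 * Real.sin θ ^ 2 ≤ c * (levelRadius G R₀ θ h * Real.sin θ) ^ 2 := by
      rw [mul_pow, ← mul_assoc]
      gcongr
    rcases le_total |levelRadius G R₀ θ h * Real.sin θ| X₀ with hle | hle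
    · have h1 := (abs_le.1 (hw θ hle)).1
      have h2 : (levelRadius G R₀ θ h * Real.sin θ) ^ 2 ≤ X₀ ^ 2 := by
        rw [← sq_abs]
        gcongr
      nlinarith
    · have h1 := hG.levelWeight_ge hg hh hle
      have : 0 ≤ c * X₀ ^ 2 := by positivity
      linarith
  have hs : IntervalIntegrable (fun θ => c * r ^ 2 * Real.sin θ ^ 2)
      MeasureTheory.volume 0 Real.pi := by
    apply Continuous.intervalIntegrable
    fun_prop
  have := intervalIntegral.integral_mono_on Real.pi_pos.le
    (hs.sub (intervalIntegrable_const (c := A + c * X₀ ^ 2)))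
    (hwc.intervalIntegrable _ _) fun θ _ => hpt θ
  rw [intervalIntegral.integral_sub hs intervalIntegrable_const,
    intervalIntegral.integral_const_mul, intervalIntegral.integral_const, integral_sin_sq,
    smul_eq_mul] at this
  simp only [Real.sin_zero, Real.sin_pi, zero_mul, sub_zero, zero_add] at this
  simp only [levelMoment, mul_zero, pow_zero, one_mul]
  linarith

theorem tendsto_levelMoment (hG : RadialPotential G g R₀ H₀) (hg : CoerciveForce g c X₀ C)
    (j : ℕ) : Tendsto (levelMoment G g R₀ j) atTop atTop := by
  induction j with
  | zero => exact hG.tendsto_levelMoment_zero hg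
  | succ j ih =>
    obtain ⟨A, hA⟩ := hG.levelMoment_succ_ge hg j le_rfl
    refine tendsto_atTop_mono' _ hA (tendsto_atTop_add_const_right _ _ ?_)
    exact ih.const_mul_atTop (pow_pos hg.X₀_pos 2)

theorem levelMoment_isLittleO (hG : RadialPotential G g R₀ H₀) (hg : CoerciveForce g c X₀ C)
    (j : ℕ) : levelMoment G g R₀ j =o[atTop] levelMoment G g R₀ (j + 1) := by
  refine Asymptotics.isLittleO_iff.2 fun ε hε => ?_
  obtain ⟨K, hK1, hK2⟩ : ∃ K, X₀ ≤ K ∧ ε⁻¹ + 1 ≤ K ^ 2 :=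
    ((eventually_ge_atTop X₀).and
      ((tendsto_pow_atTop (α := ℝ) (two_ne_zero)).eventually_ge_atTop _)).exists
  obtain ⟨A, hA⟩ := hG.levelMoment_succ_ge hg j hK1
  filter_upwards [hA, (hG.tendsto_levelMoment hg j).eventually_ge_atTop A,
    (hG.tendsto_levelMoment hg j).eventually_ge_atTop 0,
    (hG.tendsto_levelMoment hg (j + 1)).eventually_ge_atTop 0] with h h1 h2 h3 h4
  rw [Real.norm_of_nonneg h3, Real.norm_of_nonneg h4, ← inv_mul_le_iff₀ hε]
  nlinarith

end RadialPotential

namespace RadialPotential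

variable {G g F₂ : ℝ → ℝ} {R₀ H₀ : ℝ}

theorem integral_mCoeff_eq_neg_sum (hG : RadialPotential G g R₀ H₀) (hF₂ : ContDiff ℝ 2 F₂)
    (hF₂e : ∀ x, F₂ (-x) = F₂ x) (s : Finset ℕ) (b : ℕ → ℝ) {h : ℝ} (hh : H₀ < h) :
    ∫ θ in (0 : ℝ)..Real.pi,
      mCoeff (polarRhs G g F₂ (fun x => ∑ j ∈ s, b j * x ^ (2 * j + 1)) R₀) θ h =
      -∑ j ∈ s, b j * levelMoment G g R₀ j h := by
  have hr := hG.continuous_levelRadius hh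
  have hw := hG.continuous_levelWeight hh
  have hpt : ∀ θ, mCoeff (polarRhs G g F₂ (fun x => ∑ j ∈ s, b j * x ^ (2 * j + 1)) R₀) θ h =
      -∑ j ∈ s, b j * ((levelRadius G R₀ θ h * Real.sin θ) ^ (2 * j) *
        levelWeight G g R₀ θ h) := fun θ => by
    rw [hG.mCoeff_polarRhs hF₂ (by fun_prop) hF₂e (fun x => ?_) hh]
    · rw [mul_assoc, mul_div_assoc, Finset.sum_mul]
      congr 1
      refine Finset.sum_congr rfl fun j _ => ?_
      simp only [levelWeight]
      ring
    · rw [← Finset.sum_neg_distrib]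
      refine Finset.sum_congr rfl fun j _ => ?_
      rw [Odd.neg_pow ⟨j, rfl⟩]
      ring
  simp only [hpt]
  rw [intervalIntegral.integral_neg, intervalIntegral.integral_finsetSum]
  · simp only [intervalIntegral.integral_const_mul, levelMoment]
  · intro j _
    apply Continuous.intervalIntegrable
    fun_prop

theorem hasDerivAt_sum_levelMoment (hG : RadialPotential G g R₀ H₀) (hF₂ : ContDiff ℝ 2 F₂)
    (hF₂e : ∀ x, F₂ (-x) = F₂ x) (s : Finset ℕ) (b : ℕ → ℝ) {z : ℝ} (hz : H₀ < z) :
    HasDerivAt (fun h => ∑ j ∈ s, b j * levelMoment G g R₀ j h)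
      (-∫ θ in (0 : ℝ)..Real.pi,
        mCoeff (hDeriv (polarRhs G g F₂ (fun x => ∑ j ∈ s, b j * x ^ (2 * j + 1)) R₀)) θ z) z := by
  have hR := hG.reversibleField (F₁ := fun x => ∑ j ∈ s, b j * x ^ (2 * j + 1)) hF₂
    (by fun_prop) hF₂e (fun x => by
      rw [← Finset.sum_neg_distrib]
      refine Finset.sum_congr rfl fun j _ => ?_
      rw [Odd.neg_pow ⟨j, rfl⟩]
      ring) hz
  refine hR.hasDerivAt_integral_mCoeff.neg.congr_of_eventuallyEq ?_
  filter_upwards [eventually_gt_nhds hz] with h hh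
  simp only [Pi.neg_apply]
  rw [hG.integral_mCoeff_eq_neg_sum hF₂ hF₂e s b hh, neg_neg]

theorem differentiableAt_levelMoment (hG : RadialPotential G g R₀ H₀) (j : ℕ) {z : ℝ}
    (hz : H₀ < z) : DifferentiableAt ℝ (levelMoment G g R₀ j) z := by
  have := (hG.hasDerivAt_sum_levelMoment (F₂ := fun _ => 0) contDiff_const (fun _ => rfl) {j}
    (fun _ => 1) hz).differentiableAt
  simpa using this

end RadialPotential

theorem isCompact_planarHam_le {G : ℝ → ℝ} (hG : Continuous G)
    (hinf : Tendsto G (cocompact ℝ) atTop) (A B : ℝ) :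
    IsCompact {p : ℝ × ℝ | A ≤ planarHam G p ∧ planarHam G p ≤ B} := by
  obtain ⟨x₀, hx₀⟩ := hG.exists_forall_le hinf
  obtain ⟨K, hK, hKB⟩ := mem_cocompact.1 (hinf.eventually_gt_atTop B)
  have hc : Continuous (planarHam G) := by
    unfold planarHam
    fun_prop
  set r := √(2 * (B - G x₀)) with hr
  refine (hK.prod (isCompact_Icc (a := -r) (b := r))).of_isClosed_subset
    ((isClosed_le continuous_const hc).inter (isClosed_le hc continuous_const)) ?_
  rintro ⟨x, y⟩ ⟨-, hp⟩
  simp only [planarHam] at hp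
  refine ⟨?_, abs_le.1 (Real.abs_le_sqrt ?_)⟩
  · by_contra hx
    have : B < G x := hKB hx
    linarith [sq_nonneg y]
  · have := hx₀ x
    simp only
    linarith

theorem exists_separation {n : ℕ} {z : Fin n → ℝ} (hz : Function.Injective z) {H : ℝ}
    (hH : ∀ i, H < z i) :
    ∃ η > 0, η ≤ 1 ∧ (∀ i, H ≤ z i - η) ∧ ∀ i j, i ≠ j → 2 * η ≤ |z i - z j| := by
  have hlim : ∀ a : ℝ, 0 < a → ∀ᶠ η : ℝ in 𝓝[>] 0, 2 * η ≤ a := fun a ha => by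
    filter_upwards [Ioo_mem_nhdsGT (half_pos ha)] with η hη
    linarith [hη.2]
  have h1 : ∀ᶠ η : ℝ in 𝓝[>] 0, ∀ i, 2 * η ≤ z i - H :=
    eventually_all.2 fun i => hlim _ (sub_pos.2 (hH i))
  have h2 : ∀ᶠ η : ℝ in 𝓝[>] 0, ∀ i j, i ≠ j → 2 * η ≤ |z i - z j| := by
    refine eventually_all.2 fun i => eventually_all.2 fun j => ?_
    by_cases hij : i = j
    · simp [hij]
    · filter_upwards [hlim _ (abs_pos.2 (sub_ne_zero.2 (hz.ne hij)))] with η hη _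
      exact hη
  obtain ⟨η, ⟨h1, h2⟩, h3, h4⟩ := ((h1.and h2).and
    ((hlim 1 one_pos).and self_mem_nhdsWithin)).exists
  have h4 : 0 < η := h4
  exact ⟨η, h4, by linarith, fun i => by linarith [h1 i], h2⟩

theorem Polynomial.contDiff_eval {n : WithTop ℕ∞} (P : ℝ[X]) : ContDiff ℝ n fun x => P.eval x := by
  simpa [aeval_def, eval_map_algebraMap] using P.contDiff_aeval (𝕜 := ℝ) n

theorem stmt19 (G₂ F₂ : Polynomial ℝ)
    (hGeven : ∀ x : ℝ, G₂.eval (-x) = G₂.eval x)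
    (hFeven : ∀ x : ℝ, F₂.eval (-x) = F₂.eval x)
    (hGdeg : 2 ≤ G₂.natDegree)
    (hGinf : Tendsto (fun x : ℝ => G₂.eval x) (cocompact ℝ) atTop)
    (q : ℕ) (hq : 1 ≤ q) (U₀ : Set (ℝ × ℝ)) (hU₀ : IsCompact U₀) :
    ∃ ε₀ : ℝ, 0 < ε₀ ∧ ∃ b : ℕ → ℝ, (∀ j : ℕ, j ≤ q → b j ≠ 0) ∧
      ∃ U : Set (ℝ × ℝ), IsCompact U ∧ U ∩ U₀ = ∅ ∧
        ∀ lam mu : ℝ, |lam| ≤ ε₀ → mu ≠ 0 → |mu| ≤ ε₀ →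
          ∃ S : Finset (Set (ℝ × ℝ)),
            (∀ Γ ∈ S, IsLimitCycle
              (fun p : ℝ × ℝ =>
                (p.2 - (lam * F₂.eval p.1
                    + mu * ∑ j ∈ Finset.range (q + 1), b j * p.1 ^ (2 * j + 1)),
                 -(G₂.derivative.eval p.1))) Γ ∧ Γ ⊆ U) ∧
            q ≤ S.card := by
  obtain ⟨c, X₀, C, hg⟩ := exists_coerciveForce hGeven hGdeg hGinf
  have hGd := fun x => G₂.hasDerivAt x
  have hGc : Continuous fun x : ℝ => G₂.eval x := G₂.continuous
  obtain ⟨R₀, H₀, hG⟩ := hg.exists_radialPotential hGd G₂.derivative.contDiff_eval hGeven hGinf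
  have hHc : Continuous (planarHam fun x => G₂.eval x) := by
    unfold planarHam
    fun_prop
  obtain ⟨B, hB⟩ := hU₀.bddAbove_image hHc.continuousOn
  obtain ⟨H₂, hH₂⟩ := eventually_atTop.1 ((hG.tendsto_levelMoment hg 0).eventually_gt_atTop 0)
  set H₁ := max (max H₀ H₂) (B + 1) with hH₁
  have hH₀₁ : H₀ ≤ H₁ := (le_max_left _ _).trans (le_max_left _ _)
  obtain ⟨b, hb, z, hzinj, hz⟩ := exists_simple_zeros (H₀ := H₁)
    (fun j h hh => hG.differentiableAt_levelMoment j (hH₀₁.trans_lt hh))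
    (fun h hh => hH₂ h (((le_max_right _ _).trans (le_max_left _ _)).trans hh.le))
    (fun j => (hG.tendsto_levelMoment hg j).eventually_gt_atTop 0)
    (hG.levelMoment_isLittleO hg) q
  obtain ⟨η₁, hη₁, hη₁1, hη₁H, hsep⟩ := exists_separation hzinj fun i => (hz i).1
  obtain ⟨Z, hZ⟩ := (Set.finite_range z).bddAbove
  have hF₂c : ContDiff ℝ 2 fun x => F₂.eval x := F₂.contDiff_eval
  have hcycle : ∀ i, ∃ ε > 0, ∀ l m, |l| ≤ ε → m ≠ 0 → |m| ≤ ε →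
      ∃ Γ, IsLimitCycle (planarField (fun x => G₂.derivative.eval x) (fun x => F₂.eval x)
        (fun x => ∑ j ∈ Finset.range (q + 1), b j * x ^ (2 * j + 1)) l m) Γ ∧
        ∀ p ∈ Γ, |planarHam (fun x => G₂.eval x) p - z i| < η₁ := by
    intro i
    obtain ⟨hzH, hz0, hz'⟩ := hz i
    have hzH₀ := hH₀₁.trans_lt hzH
    have hM := hG.integral_mCoeff_eq_neg_sum hF₂c hFeven (Finset.range (q + 1)) b hzH₀
    have hM' := hG.hasDerivAt_sum_levelMoment hF₂c hFeven (Finset.range (q + 1)) b hzH₀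
    rw [hM'.deriv, neg_ne_zero] at hz'
    rw [hz0, neg_zero] at hM
    obtain ⟨η₀, hη₀, hex⟩ := hG.exists_isLimitCycle hF₂c (by fun_prop) hFeven (fun x => by
      rw [← Finset.sum_neg_distrib]
      refine Finset.sum_congr rfl fun j _ => ?_
      rw [Odd.neg_pow ⟨j, rfl⟩]
      ring) hzH₀ hM hz'
    obtain ⟨ε, hε, hsol⟩ := hex (min η₀ η₁) (lt_min hη₀ hη₁) (min_le_left _ _)
    refine ⟨ε, hε, fun l m hl hm0 hm => ?_⟩
    obtain ⟨Γ, hΓ, hΓz⟩ := hsol l m hl hm0 hm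
    exact ⟨Γ, hΓ, fun p hp => (hΓz p hp).trans_le (min_le_right _ _)⟩
  choose ε hε hcyc using hcycle
  have : Nonempty (Fin q) := ⟨⟨0, hq⟩⟩
  refine ⟨Finset.univ.inf' Finset.univ_nonempty ε, by simpa using hε, b, hb,
    {p | H₁ ≤ planarHam (fun x => G₂.eval x) p ∧ planarHam (fun x => G₂.eval x) p ≤ Z + 1},
    isCompact_planarHam_le hGc hGinf _ _, ?_, fun l m hl hm0 hm => ?_⟩
  · refine Set.eq_empty_of_forall_notMem fun p hp => ?_
    have h1 := hB (Set.mem_image_of_mem _ hp.2)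
    have h2 := hp.1.1
    have h3 : B + 1 ≤ H₁ := le_max_right _ _
    linarith
  · have hle : ∀ i, Finset.univ.inf' Finset.univ_nonempty ε ≤ ε i := fun i =>
      Finset.inf'_le _ (Finset.mem_univ i)
    choose Γ hΓ hΓz using fun i => hcyc i l m (hl.trans (hle i)) hm0 (hm.trans (hle i))
    have hinj : Function.Injective Γ := by
      intro i j hij
      by_contra hne
      obtain ⟨⟨γ, -, -, -, hγ⟩, -⟩ := hΓ i
      have hmem : γ 0 ∈ Γ i := by
        rw [hγ]
        exact ⟨0, rfl⟩
      have h1 := hΓz i _ hmem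
      have h2 := hΓz j _ (hij ▸ hmem)
      have h3 := hsep i j hne
      rw [abs_sub_comm] at h1
      have h4 := abs_sub_le (z i) (planarHam (fun x => G₂.eval x) (γ 0)) (z j)
      linarith
    refine ⟨Finset.univ.map ⟨Γ, hinj⟩, fun Γ' hΓ' => ?_, by simp⟩
    obtain ⟨i, -, rfl⟩ := Finset.mem_map.1 hΓ'
    refine ⟨hΓ i, fun p hp => ?_⟩
    have h1 := abs_lt.1 (hΓz i p hp)
    have h2 := hη₁H i
    have h3 : z i ≤ Z := hZ ⟨i, rfl⟩
    constructor <;> linarith
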